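/- arXiv:1603.06167 — 2 statements merged into one kernel-verified Lean document; each statement's English description precedes it below -/
import Mathlib

section
/- Let κ > 1 and X₀, Y = (y, y_{n+1}) ∈ ℝ^{n+1} with c(X₀,Y) > 0 (hence X₀ ≠ Y). Then for all x ∈ ℝⁿ, all 1 ≤ i ≤ n and all 1 ≤ j ≤ n+1, the mixed second derivative of φ in the variables x and Y satisfies |∂²φ/∂x_i∂y_j(x, Y, X₀)| ≤ (2 + (1/2)√((κ+1)/(κ−1)))/c(X₀,Y), where y_j ranges over the coordinates of Y. -/
noncomputable section

open scoped RealInnerProductSpace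

/-- ℝⁿ with the Euclidean norm. -/
abbrev E (n : ℕ) : Type := EuclideanSpace ℝ (Fin n)

/-- Euclidean norm of a point of ℝ^{n+1} = ℝⁿ × ℝ. -/
def pnorm {n : ℕ} (W : E n × ℝ) : ℝ := Real.sqrt (‖W.1‖ ^ 2 + W.2 ^ 2)

/-- c(X,Y) = κ(y_{n+1} − x_{n+1}) − |X − Y|. -/
def cfun {n : ℕ} (κ : ℝ) (X Y : E n × ℝ) : ℝ := κ * (Y.2 - X.2) - pnorm (X - Y)

/-- φ_{Y,b}(x): lower sheet of the two-sheeted hyperboloid with upper focus Y. -/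
def hypb {n : ℕ} (κ : ℝ) (Y : E n × ℝ) (b : ℝ) (x : E n) : ℝ :=
  Y.2 - κ * b / (κ ^ 2 - 1) -
    Real.sqrt (b ^ 2 / (κ ^ 2 - 1) ^ 2 + ‖x - Y.1‖ ^ 2 / (κ ^ 2 - 1))

/-- φ(x, Y, X₀) = φ_{Y, c(X₀,Y)}(x). -/
def hyp {n : ℕ} (κ : ℝ) (x : E n) (Y X₀ : E n × ℝ) : ℝ := hypb κ Y (cfun κ X₀ Y) x

/-- Mixed second derivative of φ: first in x (direction eᵢ), then in Y (direction w). -/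
def mixedDeriv {n : ℕ} (κ : ℝ) (x : E n) (X₀ : E n × ℝ) (i : Fin n) (Y : E n × ℝ)
    (w : E n × ℝ) : ℝ :=
  fderiv ℝ (fun P : E n × ℝ =>
    fderiv ℝ (fun z => hyp κ z P X₀) x (EuclideanSpace.single i (1:ℝ))) Y w

lemma inner_deriv {n : ℕ} (κ : ℝ) (hκ : 1 < κ) (X₀ P : E n × ℝ) (hc : 0 < cfun κ X₀ P)
    (x : E n) (i : Fin n) :
    fderiv ℝ (fun z => hyp κ z P X₀) x (EuclideanSpace.single i (1:ℝ)) =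
      -((x - P.1) i) / Real.sqrt ((cfun κ X₀ P) ^ 2 + (κ ^ 2 - 1) * ‖x - P.1‖ ^ 2) := by
  have hm : 0 < κ ^ 2 - 1 := by nlinarith
  set m := κ ^ 2 - 1 with hmdef
  set b := cfun κ X₀ P with hb
  have hpos : 0 < b ^ 2 / m ^ 2 + ‖x - P.1‖ ^ 2 / m := by positivity
  have h1 : HasFDerivAt (fun z : E n => z - P.1) (ContinuousLinearMap.id ℝ (E n)) x :=
    (hasFDerivAt_id x).sub_const _
  have h2 := h1.norm_sq
  have h3 := (((h2.mul_const m⁻¹).const_add (b ^ 2 / m ^ 2)).sqrt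
    (by rw [← div_eq_mul_inv]; exact hpos.ne')).const_sub (P.2 - κ * b / m)
  have h4 : HasFDerivAt (fun z => hyp κ z P X₀) _ x := h3
  rw [h4.fderiv]
  have hs : Real.sqrt (b ^ 2 / m ^ 2 + ‖x - P.1‖ ^ 2 * m⁻¹)
      = Real.sqrt (b ^ 2 + m * ‖x - P.1‖ ^ 2) / m := by
    rw [← Real.sqrt_sq hm.le, ← Real.sqrt_div' _ (by positivity), Real.sqrt_sq hm.le]
    congr 1
    field_simp
  have hR : 0 < Real.sqrt (b ^ 2 + m * ‖x - P.1‖ ^ 2) := Real.sqrt_pos.2 (by positivity)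
  rw [hs]
  simp [EuclideanSpace.inner_single_right]
  field_simp
  try ring

lemma alg_bound (κ b z zz q v R D : ℝ) (hκ : 1 < κ) (hb : 0 < b) (hR : 0 < R)
    (hR2 : R ^ 2 = b ^ 2 + (κ ^ 2 - 1) * zz) (hz : z ^ 2 ≤ zz) (hq : q ^ 2 ≤ zz)
    (hv : |v| ≤ 1) (hD : |D| ≤ κ + 1) :
    |v / R + z * (b * D - (κ ^ 2 - 1) * q) / R ^ 3|
      ≤ (2 + (1 / 2) * Real.sqrt ((κ + 1) / (κ - 1))) / b := by
  have hm : 0 < κ ^ 2 - 1 := by nlinarith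
  have hzz : 0 ≤ zz := le_trans (sq_nonneg _) hz
  have hbR : b ≤ R := by
    exact (sq_le_sq₀ hb.le hR.le).1 (by nlinarith [mul_nonneg hm.le hzz])
  set s := Real.sqrt ((κ + 1) / (κ - 1)) with hs
  have hk : 0 < κ - 1 := by linarith
  have hs0 : 0 ≤ s := Real.sqrt_nonneg _
  have hs2 : s ^ 2 * (κ - 1) = κ + 1 := by
    rw [hs, Real.sq_sqrt (by positivity)]; field_simp
  have e1 : |v / R| ≤ 1 / b := by
    rw [abs_div, abs_of_pos hR]
    exact div_le_div₀ zero_le_one hv hb hbR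
  have e2 : |(κ ^ 2 - 1) * (z * q) / R ^ 3| ≤ 1 / b := by
    have : |z * q| ≤ zz := abs_le.2 ⟨by nlinarith [sq_nonneg (z + q)], by nlinarith [sq_nonneg (z - q)]⟩
    rw [abs_div, abs_of_pos (pow_pos hR 3), abs_mul, abs_of_pos hm]
    have h2 : (κ ^ 2 - 1) * |z * q| ≤ R ^ 2 := by nlinarith [mul_le_mul_of_nonneg_left this hm.le]
    rw [div_le_div_iff₀ (by positivity) hb]
    have : R ^ 2 * b ≤ R ^ 2 * R := by gcongr
    nlinarith
  have e3 : |z * b * D / R ^ 3| ≤ (1 / 2) * s / b := by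
    rw [abs_div, abs_of_pos (pow_pos hR 3), abs_mul, abs_mul, abs_of_pos hb]
    have h1 : |z| * b * (κ + 1) ≤ 1 / 2 * s * R ^ 2 := by
      have hz2 : |z| ^ 2 ≤ zz := by rwa [sq_abs]
      have hkk : (κ + 1) ^ 2 = s ^ 2 * (κ ^ 2 - 1) := by linear_combination (-(κ + 1)) * hs2
      have hss : 0 < s := Real.sqrt_pos.2 (by positivity)
      -- s*(κ-1)*s = κ+1
      have h5 : 2 * b * (s * (κ - 1) * |z|) ≤ R ^ 2 := by
        have h6 : (s * (κ - 1) * |z|) ^ 2 ≤ (κ ^ 2 - 1) * zz := by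
          have : (s * (κ - 1) * |z|) ^ 2 = (κ ^ 2 - 1) * |z| ^ 2 := by
            linear_combination (κ - 1) * |z| ^ 2 * hs2
          rw [this]; gcongr
        nlinarith [sq_nonneg (b - s * (κ - 1) * |z|)]
      have h7 : |z| * b * (κ + 1) = 1 / 2 * s * (2 * b * (s * (κ - 1) * |z|)) := by
        linear_combination (-(|z| * b)) * hs2
      rw [h7]; gcongr
    have h2 : |z| * b * |D| ≤ 1 / 2 * s * R ^ 2 := le_trans (by gcongr) h1
    rw [div_le_div_iff₀ (by positivity) hb]
    calc |z| * b * |D| * b ≤ 1 / 2 * s * R ^ 2 * R := by gcongr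
      _ = _ := by ring
  have : v / R + z * (b * D - (κ ^ 2 - 1) * q) / R ^ 3
      = v / R + z * b * D / R ^ 3 - (κ ^ 2 - 1) * (z * q) / R ^ 3 := by ring
  rw [this]
  have t1 := abs_sub (v / R + z * b * D / R ^ 3) ((κ ^ 2 - 1) * (z * q) / R ^ 3)
  have t2 := abs_add_le (v / R) (z * b * D / R ^ 3)
  have : (2 + (1 / 2) * s) / b = 1 / b + 1 / b + (1 / 2) * s / b := by ring
  rw [this]; linarith

lemma pnorm_pos {n : ℕ} (κ : ℝ) (X Y : E n × ℝ) (hc : 0 < cfun κ X Y) :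
    0 < ‖X.1 - Y.1‖ ^ 2 + (X.2 - Y.2) ^ 2 := by
  by_contra h
  have h1 : (X.2 - Y.2) ^ 2 = 0 := by nlinarith [sq_nonneg ‖X.1 - Y.1‖, sq_nonneg (X.2 - Y.2)]
  have h2 : Y.2 - X.2 = 0 := by have := pow_eq_zero_iff (two_ne_zero) |>.1 h1; linarith
  have : 0 ≤ pnorm (X - Y) := Real.sqrt_nonneg _
  unfold cfun at hc
  rw [h2] at hc
  linarith

lemma cfun_line {n : ℕ} (κ : ℝ) (hκ : 1 < κ) (X Y w : E n × ℝ) (hc : 0 < cfun κ X Y)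
    (hw : (∃ j : Fin n, w = (EuclideanSpace.single j (1:ℝ), (0:ℝ))) ∨ w = (0, (1:ℝ))) :
    ∃ D, |D| ≤ κ + 1 ∧ HasDerivAt (fun t : ℝ => cfun κ X (Y + t • w)) D 0 := by
  have hp := pnorm_pos κ X Y hc
  have h1 : HasDerivAt (fun t : ℝ => X.1 - (Y.1 + t • w.1)) (-w.1) 0 := by
    simpa using (((hasDerivAt_id (0:ℝ)).smul_const w.1).const_add Y.1).const_sub X.1
  have h2 : HasDerivAt (fun t : ℝ => X.2 - (Y.2 + t * w.2)) (-w.2) 0 := by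
    simpa using (((hasDerivAt_id (0:ℝ)).mul_const w.2).const_add Y.2).const_sub X.2
  have h2' : HasDerivAt (fun t : ℝ => κ * ((Y.2 + t * w.2) - X.2)) (κ * w.2) 0 := by
    simpa using ((((hasDerivAt_id (0:ℝ)).mul_const w.2).const_add Y.2).sub_const X.2).const_mul κ
  have h3 := h2'.sub ((h1.norm_sq.add (h2.pow 2)).sqrt (by simpa using hp.ne'))
  refine ⟨_, ?_, h3⟩
  set r := ‖X.1 - Y.1‖ ^ 2 + (X.2 - Y.2) ^ 2 with hr
  have hr0 : 0 < Real.sqrt r := Real.sqrt_pos.2 hp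
  have a1 : ‖X.1 - Y.1‖ ≤ Real.sqrt r := Real.le_sqrt_of_sq_le (by nlinarith [sq_nonneg (X.2 - Y.2)])
  have a2 : |X.2 - Y.2| ≤ Real.sqrt r :=
    Real.le_sqrt_of_sq_le (by rw [sq_abs]; nlinarith [sq_nonneg ‖X.1 - Y.1‖])
  rcases hw with ⟨j, rfl⟩ | rfl
  · have a3 : |(X.1 - Y.1) j| ≤ ‖X.1 - Y.1‖ := by simpa using PiLp.norm_apply_le (X.1 - Y.1) j
    have a4 : |(2 * (X.1 - Y.1) j) / (2 * Real.sqrt r)| ≤ 1 := by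
      rw [mul_div_mul_left _ _ two_ne_zero, abs_div, abs_of_pos hr0]
      exact (div_le_one hr0).2 (a3.trans a1)
    simp [EuclideanSpace.inner_single_right, ← hr] at a4 ⊢
    rw [← abs_neg, show -(2 * (Y.1.ofLp j - X.1.ofLp j) / (2 * Real.sqrt r))
      = 2 * (X.1.ofLp j - Y.1.ofLp j) / (2 * Real.sqrt r) by ring]
    linarith
  · have a4 : |(2 * (X.2 - Y.2)) / (2 * Real.sqrt r)| ≤ 1 := by
      rw [mul_div_mul_left _ _ two_ne_zero, abs_div, abs_of_pos hr0]
      exact (div_le_one hr0).2 a2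
    simp [← hr] at a4 ⊢
    rw [neg_div, sub_neg_eq_add]
    refine (abs_add_le _ _).trans ?_
    rw [abs_of_pos (by linarith : 0 < κ)]
    linarith

theorem stmt_4 {n : ℕ} (hn : 1 ≤ n) (κ : ℝ) (hκ : 1 < κ)
    (X₀ Y : E n × ℝ) (hc : 0 < cfun κ X₀ Y) (x : E n) (i : Fin n)
    (w : E n × ℝ)
    (hw : (∃ j : Fin n, w = (EuclideanSpace.single j (1:ℝ), (0:ℝ))) ∨ w = (0, (1:ℝ))) :
    |mixedDeriv κ x X₀ i Y w|
      ≤ (2 + (1 / 2) * Real.sqrt ((κ + 1) / (κ - 1))) / cfun κ X₀ Y := by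
  unfold mixedDeriv
  set g := fun P : E n × ℝ =>
    fderiv ℝ (fun z => hyp κ z P X₀) x (EuclideanSpace.single i (1:ℝ)) with hg
  by_cases hd : DifferentiableAt ℝ g Y
  swap
  · rw [fderiv_zero_of_not_differentiableAt hd]
    simp only [zero_apply, abs_zero]
    positivity
  rw [← hd.lineDeriv_eq_fderiv]
  obtain ⟨D, hD, hcd⟩ := cfun_line κ hκ X₀ Y w hc hw
  have hm : 0 < κ ^ 2 - 1 := by nlinarith
  have hev : ∀ᶠ t in nhds (0:ℝ), 0 < cfun κ X₀ (Y + t • w) :=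
    hcd.continuousAt.eventually (lt_mem_nhds (by simpa using hc))
  have heq : (fun t : ℝ => g (Y + t • w)) =ᶠ[nhds 0] fun t : ℝ =>
      -((x - (Y.1 + t • w.1)) i) / Real.sqrt ((cfun κ X₀ (Y + t • w)) ^ 2
        + (κ ^ 2 - 1) * ‖x - (Y.1 + t • w.1)‖ ^ 2) := by
    filter_upwards [hev] with t ht
    exact inner_deriv κ hκ X₀ _ ht x i
  unfold lineDeriv
  rw [heq.deriv_eq]
  have h1 : HasDerivAt (fun t : ℝ => x - (Y.1 + t • w.1)) (-w.1) 0 := by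
    simpa using (((hasDerivAt_id (0:ℝ)).smul_const w.1).const_add Y.1).const_sub x
  have h2 : HasDerivAt (fun t : ℝ => -((x - (Y.1 + t • w.1)) i)) (w.1 i) 0 := by
    have h := (((((hasDerivAt_id (0:ℝ)).mul_const (w.1 i)).const_add (Y.1 i)).const_sub (x i))).neg
    rw [one_mul, neg_neg] at h
    exact h
  set b := cfun κ X₀ Y with hb
  have hpos : 0 < b ^ 2 + (κ ^ 2 - 1) * ‖x - Y.1‖ ^ 2 := by positivity
  have hR : 0 < Real.sqrt (b ^ 2 + (κ ^ 2 - 1) * ‖x - Y.1‖ ^ 2) := Real.sqrt_pos.2 hpos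
  have h3 := h2.div (((hcd.pow 2).add (h1.norm_sq.const_mul (κ ^ 2 - 1))).sqrt
    (by simpa [← hb] using hpos.ne')) (by simpa [← hb] using hR.ne')
  have h4 := h3.deriv
  refine le_of_eq_of_le (congrArg abs (h4.trans ?_))
    (alg_bound κ b ((x - Y.1) i) (‖x - Y.1‖ ^ 2) (inner ℝ (x - Y.1) w.1) (w.1 i)
      (Real.sqrt (b ^ 2 + (κ ^ 2 - 1) * ‖x - Y.1‖ ^ 2)) D hκ hc hR (Real.sq_sqrt hpos.le)
      ?_ ?_ ?_ hD)
  · simp [← hb]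
    set R := Real.sqrt (b ^ 2 + (κ ^ 2 - 1) * ‖x - Y.1‖ ^ 2) with hRdef
    rw [Real.sq_sqrt hpos.le] 
    have hR2 : R ^ 2 = b ^ 2 + (κ ^ 2 - 1) * ‖x - Y.1‖ ^ 2 := Real.sq_sqrt hpos.le
    rw [← hR2]
    field_simp
    ring
  · have : |(x - Y.1) i| ≤ ‖x - Y.1‖ := by simpa using PiLp.norm_apply_le (x - Y.1) i
    rw [← sq_abs]; gcongr
  · rcases hw with ⟨j, rfl⟩ | rfl
    · have : |(x - Y.1) j| ≤ ‖x - Y.1‖ := by simpa using PiLp.norm_apply_le (x - Y.1) j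
      simp only [EuclideanSpace.inner_single_right]
      simp only [one_mul, conj_trivial]
      rw [← sq_abs]; gcongr
    · simp
  · rcases hw with ⟨j, rfl⟩ | rfl
    · by_cases h : i = j <;> simp [h]
    · simp
end
end

section
/- (C^{1,α} estimate.) Suppose u is a parallel refractor under the structural setup, Σ is regular from X* = (x*, u(x*)), and the target measure σ satisfies the growth conditions (i) and (ii) at X*. Then there exist δ, M, C₂ > 0 depending on X* such that if x̄, x̂ ∈ B_{δ/2}(x*), Ȳ ∈ F_u(x̄) and Ŷ ∈ F_u(x̂) satisfy |Ȳ − Ŷ| ≥ max{1, (2M/δ)², (2M/C₂)²}|x̄ − x̂|, then |Ȳ − Ŷ| ≤ C₁|x̄ − x̂|^α, where C₁ = C₁(C₀, C̃, M) and α = (n/(2q) − (n−1)/2)/(1 + (3/2)(n−1) + n/(2q)). Moreover, u ∈ C^{1,α}(B_{δ/2}(x*)): F_u(x) is single-valued for x ∈ B_{δ/2}(x*), u is differentiable there with Du(x̄) = D_xφ(x̄, F_u(x̄), (x̄, u(x̄))), and |Du(x̄) − Du(x̂)| ≤ C|x̄ − x̂|^α for all x̄, x̂ ∈ B_{δ/2}(x*).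 -/
noncomputable section

open scoped RealInnerProductSpace

/-- Q(v) = (κ − √(1 − (κ²−1)|v|²))/(1 + |v|²). -/
def Qf {n : ℕ} (κ : ℝ) (v : E n) : ℝ :=
  (κ - Real.sqrt (1 - (κ ^ 2 - 1) * ‖v‖ ^ 2)) / (1 + ‖v‖ ^ 2)

/-- Λ(v) = (Q(v)v, −Q(v) + κ), the refracted unit direction. -/
def Λf {n : ℕ} (κ : ℝ) (v : E n) : E n × ℝ := (Qf κ v • v, κ - Qf κ v)

/-- The point of the target in the direction Λ(v) from Z: Y(v) = Z + s_Z(Λ(v))Λ(v). -/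
def YofZ {n : ℕ} (κ : ℝ) (sfun : (E n × ℝ) → (E n × ℝ) → ℝ) (Z : E n × ℝ)
    (v : E n) : E n × ℝ :=
  Z + sfun Z (Λf κ v) • Λf κ v

/-- The point Y_Z(λ) on the "segment" [Ȳ, Ŷ]_Z obtained by interpolating the
gradients v̄ = D_xφ(z, Ȳ, Z), v̂ = D_xφ(z, Ŷ, Z). -/
def YZlam {n : ℕ} (κ : ℝ) (sfun : (E n × ℝ) → (E n × ℝ) → ℝ) (Z : E n × ℝ)
    (Yb Yh : E n × ℝ) (lam : ℝ) : E n × ℝ :=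
  YofZ κ sfun Z ((1 - lam) • gradient (fun z => hyp κ z Yb Z) Z.1
    + lam • gradient (fun z => hyp κ z Yh Z) Z.1)

/-- The refractor-normal map F_u(x̄) = {Y ∈ Σ : u ≥ φ(·, Y, (x̄, u(x̄))) on Ω}. -/
def Fu {n : ℕ} (κ : ℝ) (Ω : Set (E n)) (Tgt : Set (E n × ℝ)) (u : E n → ℝ)
    (xb : E n) : Set (E n × ℝ) :=
  {Y ∈ Tgt | ∀ x ∈ Ω, hyp κ x Y (xb, u xb) ≤ u x}

/-- The Hölder exponent α = (n/(2q) − (n−1)/2)/(1 + (3/2)(n−1) + n/(2q)). -/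
def alphaExp (n : ℕ) (q : ℝ) : ℝ :=
  ((n : ℝ) / (2 * q) - ((n : ℝ) - 1) / 2) /
    (1 + (3 / 2) * ((n : ℝ) - 1) + (n : ℝ) / (2 * q))

/-! ### Basic facts on hyperboloids -/

def rho {n : ℕ} (κ : ℝ) (Z Y : E n × ℝ) : ℝ :=
  (κ * pnorm (Z - Y) - (Y.2 - Z.2)) / (κ ^ 2 - 1)

def Rr {n : ℕ} (κ : ℝ) (Z Y : E n × ℝ) (x : E n) : ℝ :=
  Real.sqrt (cfun κ Z Y ^ 2 / (κ ^ 2 - 1) ^ 2 + ‖x - Y.1‖ ^ 2 / (κ ^ 2 - 1))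

def Good {n : ℕ} (κ Δ T1 : ℝ) (Z Y : E n × ℝ) : Prop :=
  ‖Y.1 - Z.1‖ ≤ Δ ∧ κ * Δ / (κ - 1) ≤ Y.2 - Z.2 ∧ Y.2 - Z.2 ≤ T1

lemma pnorm_eq {n : ℕ} (W : E n × ℝ) : pnorm W = ‖WithLp.toLp 2 W‖ := by
  rw [WithLp.prod_norm_eq_of_L2]
  simp [pnorm]

lemma pnorm_nonneg {n : ℕ} (W : E n × ℝ) : 0 ≤ pnorm W := Real.sqrt_nonneg _

lemma pnorm_sq {n : ℕ} (W : E n × ℝ) : pnorm W ^ 2 = ‖W.1‖ ^ 2 + W.2 ^ 2 :=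
  Real.sq_sqrt (by positivity)

lemma pnorm_add_le {n : ℕ} (V W : E n × ℝ) : pnorm (V + W) ≤ pnorm V + pnorm W := by
  simp only [pnorm_eq, WithLp.toLp_add]
  exact norm_add_le _ _

lemma pnorm_neg {n : ℕ} (V : E n × ℝ) : pnorm (-V) = pnorm V := by
  simp [pnorm]

lemma pnorm_sub_comm {n : ℕ} (V W : E n × ℝ) : pnorm (V - W) = pnorm (W - V) := by
  rw [← pnorm_neg, neg_sub]

lemma fst_le_pnorm {n : ℕ} (W : E n × ℝ) : ‖W.1‖ ≤ pnorm W := by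
  apply Real.le_sqrt_of_sq_le
  nlinarith [sq_nonneg W.2]

lemma snd_le_pnorm {n : ℕ} (W : E n × ℝ) : |W.2| ≤ pnorm W := by
  apply Real.le_sqrt_of_sq_le
  rw [sq_abs]
  nlinarith [sq_nonneg ‖W.1‖]

lemma pnorm_le {n : ℕ} (W : E n × ℝ) : pnorm W ≤ ‖W.1‖ + |W.2| := by
  apply Real.sqrt_le_iff.2
  constructor
  · positivity
  · have := sq_abs W.2
    nlinarith [norm_nonneg W.1, abs_nonneg W.2, mul_nonneg (norm_nonneg W.1) (abs_nonneg W.2)]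

lemma pnorm_eq_zero {n : ℕ} {W : E n × ℝ} (h : pnorm W = 0) : W = 0 := by
  have h1 := fst_le_pnorm W
  have h2 := snd_le_pnorm W
  rw [h] at h1 h2
  ext1
  · simpa using h1
  · simpa using h2

lemma hyp_eq {n : ℕ} {κ : ℝ} (hκ : 1 < κ) (Z Y : E n × ℝ) (x : E n) :
    hyp κ x Y Z = Z.2 + rho κ Z Y - Rr κ Z Y x := by
  have hK : κ ^ 2 - 1 ≠ 0 := by nlinarith
  unfold hyp hypb rho Rr
  congr 1
  unfold cfun
  field_simp
  ring

lemma Rr_nonneg {n : ℕ} (κ : ℝ) (Z Y : E n × ℝ) (x : E n) : 0 ≤ Rr κ Z Y x :=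
  Real.sqrt_nonneg _

lemma Rr_sq {n : ℕ} {κ : ℝ} (hκ : 1 < κ) (Z Y : E n × ℝ) (x : E n) :
    Rr κ Z Y x ^ 2 = cfun κ Z Y ^ 2 / (κ ^ 2 - 1) ^ 2 + ‖x - Y.1‖ ^ 2 / (κ ^ 2 - 1) := by
  have hK : 0 < κ ^ 2 - 1 := by nlinarith
  exact Real.sq_sqrt (by positivity)

lemma rho_sq {n : ℕ} {κ : ℝ} (hκ : 1 < κ) (Z Y : E n × ℝ) :
    rho κ Z Y ^ 2 = cfun κ Z Y ^ 2 / (κ ^ 2 - 1) ^ 2 + ‖Y.1 - Z.1‖ ^ 2 / (κ ^ 2 - 1) := by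
  have hK : κ ^ 2 - 1 ≠ 0 := by nlinarith
  have h := pnorm_sq (Z - Y)
  have h1 : ‖(Z - Y).1‖ = ‖Y.1 - Z.1‖ := by
    rw [Prod.fst_sub, norm_sub_rev]
  rw [h1] at h
  simp only [Prod.snd_sub] at h
  unfold rho cfun
  field_simp
  linear_combination (κ ^ 2 - 1) * h

lemma Rr_sq' {n : ℕ} {κ : ℝ} (hκ : 1 < κ) (Z Y : E n × ℝ) (x : E n) :
    Rr κ Z Y x ^ 2 = rho κ Z Y ^ 2 +
      (‖x - Z.1‖ ^ 2 - 2 * ⟪x - Z.1, Y.1 - Z.1⟫) / (κ ^ 2 - 1) := by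
  rw [Rr_sq hκ, rho_sq hκ]
  have h : ‖x - Y.1‖ ^ 2 = ‖x - Z.1‖ ^ 2 - 2 * ⟪x - Z.1, Y.1 - Z.1⟫ + ‖Y.1 - Z.1‖ ^ 2 := by
    rw [← norm_sub_sq_real]
    congr 2
    abel
  rw [h]
  ring

/-- the quadratic equation of the hyperboloid -/
lemma quad {n : ℕ} {κ : ℝ} (hκ : 1 < κ) (Z Y : E n × ℝ) (x : E n) (g : ℝ) :
    2 * ⟪x - Z.1, Y.1 - Z.1⟫ - 2 * (κ ^ 2 - 1) * rho κ Z Y * g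
      - (‖x - Z.1‖ ^ 2 - (κ ^ 2 - 1) * g ^ 2) =
    - (κ ^ 2 - 1) * (g - (hyp κ x Y Z - Z.2)) * (rho κ Z Y - g + Rr κ Z Y x) := by
  have hK : κ ^ 2 - 1 ≠ 0 := by nlinarith
  have h := Rr_sq' hκ Z Y x
  rw [hyp_eq hκ]
  have h2 : (κ ^ 2 - 1) * Rr κ Z Y x ^ 2 = (κ ^ 2 - 1) * rho κ Z Y ^ 2 +
      (‖x - Z.1‖ ^ 2 - 2 * ⟪x - Z.1, Y.1 - Z.1⟫) := by
    rw [h]; field_simp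
  linear_combination h2

lemma Good.T_pos {n : ℕ} {κ Δ T1 : ℝ} {Z Y : E n × ℝ} (hκ : 1 < κ) (hΔ : 0 < Δ)
    (h : Good κ Δ T1 Z Y) : κ * Δ ≤ (κ - 1) * (Y.2 - Z.2) := by
  have := h.2.1
  rw [div_le_iff₀ (by linarith)] at this
  linarith

lemma Good.s_ge {n : ℕ} {κ Δ T1 : ℝ} {Z Y : E n × ℝ} 
    (h : Good κ Δ T1 Z Y) : Y.2 - Z.2 ≤ pnorm (Z - Y) := by
  have := snd_le_pnorm (Z - Y)
  have h2 := neg_abs_le (Z - Y).2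
  simp only [Prod.snd_sub] at *
  linarith

lemma Good.s_le {n : ℕ} {κ Δ T1 : ℝ} {Z Y : E n × ℝ} (hκ : 1 < κ) (hΔ : 0 < Δ)
    (h : Good κ Δ T1 Z Y) : pnorm (Z - Y) ≤ Y.2 - Z.2 + Δ := by
  have h0 := h.T_pos hκ hΔ
  have h1 : 0 < Y.2 - Z.2 := by
    by_contra hc
    nlinarith
  have := pnorm_le (Z - Y)
  simp only [Prod.snd_sub, Prod.fst_sub] at this
  rw [abs_sub_comm, abs_of_pos h1, norm_sub_rev] at this
  linarith [h.1]

lemma Good.c_ge {n : ℕ} {κ Δ T1 : ℝ} {Z Y : E n × ℝ} (hκ : 1 < κ) (hΔ : 0 < Δ)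
    (h : Good κ Δ T1 Z Y) : (κ - 1) * Δ ≤ cfun κ Z Y := by
  have h0 := h.T_pos hκ hΔ
  have := h.s_le hκ hΔ
  unfold cfun
  linarith

lemma Good.rho_ge {n : ℕ} {κ Δ T1 : ℝ} {Z Y : E n × ℝ} (hκ : 1 < κ) (hΔ : 0 < Δ)
    (h : Good κ Δ T1 Z Y) : κ * Δ / (κ ^ 2 - 1) ≤ rho κ Z Y := by
  have hK : 0 < κ ^ 2 - 1 := by nlinarith
  have h0 := h.T_pos hκ hΔ
  have := h.s_ge
  unfold rho
  gcongr
  nlinarith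

lemma Good.rho_pos {n : ℕ} {κ Δ T1 : ℝ} {Z Y : E n × ℝ} (hκ : 1 < κ) (hΔ : 0 < Δ)
    (h : Good κ Δ T1 Z Y) : 0 < rho κ Z Y := by
  have hK : 0 < κ ^ 2 - 1 := by nlinarith
  have := h.rho_ge hκ hΔ
  have : 0 < κ * Δ / (κ ^ 2 - 1) := by positivity
  linarith

lemma Good.rho_le {n : ℕ} {κ Δ T1 : ℝ} {Z Y : E n × ℝ} (hκ : 1 < κ) (hΔ : 0 < Δ)
    (h : Good κ Δ T1 Z Y) : rho κ Z Y ≤ κ * (T1 + Δ) / (κ ^ 2 - 1) := by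
  have hK : 0 < κ ^ 2 - 1 := by nlinarith
  have h0 := h.T_pos hκ hΔ
  have h1 : 0 < Y.2 - Z.2 := by
    by_contra hc
    nlinarith
  have := h.s_le hκ hΔ
  have := h.2.2
  unfold rho
  gcongr
  nlinarith

lemma Good.R_ge {n : ℕ} {κ Δ T1 : ℝ} {Z Y : E n × ℝ} (hκ : 1 < κ) (hΔ : 0 < Δ)
    (h : Good κ Δ T1 Z Y) (x : E n) : (κ - 1) * Δ / (κ ^ 2 - 1) ≤ Rr κ Z Y x := by
  have hK : 0 < κ ^ 2 - 1 := by nlinarith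
  have h0 := h.c_ge hκ hΔ
  apply Real.le_sqrt_of_sq_le
  have h1 : ((κ - 1) * Δ / (κ ^ 2 - 1)) ^ 2 ≤ cfun κ Z Y ^ 2 / (κ ^ 2 - 1) ^ 2 := by
    rw [div_pow]
    have : 0 ≤ (κ - 1) * Δ := by nlinarith
    gcongr
  have h2 : 0 ≤ ‖x - Y.1‖ ^ 2 / (κ ^ 2 - 1) := by positivity
  linarith

lemma Good.R_pos {n : ℕ} {κ Δ T1 : ℝ} {Z Y : E n × ℝ} (hκ : 1 < κ) (hΔ : 0 < Δ)
    (h : Good κ Δ T1 Z Y) (x : E n) : 0 < Rr κ Z Y x := by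
  have hK : 0 < κ ^ 2 - 1 := by nlinarith
  have := h.R_ge hκ hΔ x
  have h2 : 0 < (κ - 1) * Δ / (κ ^ 2 - 1) := by
    have : 0 < κ - 1 := by linarith
    positivity
  linarith

/-- auxiliary: `‖w‖² ≤ τ² K ρ²` -/
lemma aux_tau {κ Δ b a ρ : ℝ} (hκ : 1 < κ) (hb : (κ - 1) * Δ ≤ b) (hΔ : 0 < Δ)
    (ha0 : 0 ≤ a) (ha : a ≤ Δ) (hρ : ρ ^ 2 = b ^ 2 / (κ ^ 2 - 1) ^ 2 + a ^ 2 / (κ ^ 2 - 1)) :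
    a ^ 2 ≤ (κ + 1) / (2 * κ) * ((κ ^ 2 - 1) * ρ ^ 2) := by
  have hK : 0 < κ ^ 2 - 1 := by nlinarith
  have hκ1 : 0 < κ - 1 := by linarith
  rw [hρ]
  have e : (κ + 1) / (2 * κ) * ((κ ^ 2 - 1) * (b ^ 2 / (κ ^ 2 - 1) ^ 2 + a ^ 2 / (κ ^ 2 - 1)))
    = (b ^ 2 / (κ - 1) + (κ + 1) * a ^ 2) / (2 * κ) := by
    have : κ - 1 ≠ 0 := hκ1.ne'
    have : κ + 1 ≠ 0 := by linarith
    have e2 : κ ^ 2 - 1 = (κ - 1) * (κ + 1) := by ring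
    rw [e2]
    field_simp
  rw [e, le_div_iff₀ (by linarith)]
  have h1 : (κ - 1) * a ≤ b := by nlinarith
  have h2 : (κ - 1) * a ^ 2 ≤ b ^ 2 / (κ - 1) := by
    rw [le_div_iff₀ hκ1]
    nlinarith [mul_nonneg hκ1.le ha0]
  nlinarith

lemma Good.G_sq {n : ℕ} {κ Δ T1 : ℝ} {Z Y : E n × ℝ} (hκ : 1 < κ) (hΔ : 0 < Δ)
    (h : Good κ Δ T1 Z Y) {x : E n} (hx : ‖x - Y.1‖ ≤ Δ) :
    (κ ^ 2 - 1) * (hyp κ x Y Z - Z.2) ^ 2 ≤ (κ + 1) / (2 * κ) * ‖x - Z.1‖ ^ 2 := by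
  have hK : 0 < κ ^ 2 - 1 := by nlinarith
  have hb := h.c_ge hκ hΔ
  have h1 := aux_tau hκ hb hΔ (norm_nonneg _) h.1 (rho_sq hκ Z Y)
  have h2 := aux_tau hκ hb hΔ (norm_nonneg _) hx (Rr_sq hκ Z Y x)
  have hρ := h.rho_pos hκ hΔ
  have hR := h.R_pos hκ hΔ x
  have hq := Rr_sq' hκ Z Y x
  have e := hyp_eq hκ Z Y x
  set ρ := rho κ Z Y
  set R := Rr κ Z Y x
  set t := (κ + 1) / (2 * κ) with ht
  have htpos : 0 < t := by positivity
  have eG : hyp κ x Y Z - Z.2 = ρ - R := by rw [e]; ring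
  rw [eG]
  have hin : ⟪x - Z.1, (x - Y.1) - (Y.1 - Z.1)⟫ = ‖x - Z.1‖ ^ 2 - 2 * ⟪x - Z.1, Y.1 - Z.1⟫ := by
    have : (x - Y.1) - (Y.1 - Z.1) = (x - Z.1) - (2:ℝ) • (Y.1 - Z.1) := by
      rw [two_smul]; abel
    rw [this, inner_sub_right, inner_smul_right, real_inner_self_eq_norm_sq]
  have hcs := abs_real_inner_le_norm (x - Z.1) ((x - Y.1) - (Y.1 - Z.1))
  have htri := norm_sub_le (x - Y.1) (Y.1 - Z.1)
  rw [hin] at hcs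
  have hE : (κ ^ 2 - 1) * (R - ρ) * (R + ρ) = ‖x - Z.1‖ ^ 2 - 2 * ⟪x - Z.1, Y.1 - Z.1⟫ := by
    have : (κ ^ 2 - 1) * (R - ρ) * (R + ρ) = (κ ^ 2 - 1) * (R ^ 2 - ρ ^ 2) := by ring
    rw [this, hq]; field_simp; ring
  have hsum : (‖x - Y.1‖ + ‖Y.1 - Z.1‖) ^ 2 ≤ t * (κ ^ 2 - 1) * (R + ρ) ^ 2 := by
    have hA : ‖x - Y.1‖ * ‖Y.1 - Z.1‖ ≤ t * (κ ^ 2 - 1) * (R * ρ) := by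
      apply abs_le_of_sq_le_sq' _ (by positivity) |>.2
      calc (‖x - Y.1‖ * ‖Y.1 - Z.1‖) ^ 2 = ‖x - Y.1‖ ^ 2 * ‖Y.1 - Z.1‖ ^ 2 := by ring
        _ ≤ (t * ((κ ^ 2 - 1) * R ^ 2)) * (t * ((κ ^ 2 - 1) * ρ ^ 2)) := by gcongr
        _ = _ := by ring
    nlinarith
  have hfin : ((κ ^ 2 - 1) * (R - ρ) * (R + ρ)) ^ 2 ≤
      ‖x - Z.1‖ ^ 2 * (t * (κ ^ 2 - 1) * (R + ρ) ^ 2) := by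
    rw [hE, ← sq_abs]
    calc _ ≤ (‖x - Z.1‖ * (‖x - Y.1‖ + ‖Y.1 - Z.1‖)) ^ 2 := by
          gcongr
          exact hcs.trans (by gcongr)
      _ = ‖x - Z.1‖ ^ 2 * (‖x - Y.1‖ + ‖Y.1 - Z.1‖) ^ 2 := by ring
      _ ≤ _ := by gcongr
  have hp : 0 < (κ ^ 2 - 1) * (R + ρ) ^ 2 := by positivity
  refine le_of_mul_le_mul_right ?_ hp
  nlinarith

/-- Lipschitz bound with constant `1/√K`, in squared form. -/
lemma Good.G_sq' {n : ℕ} {κ Δ T1 : ℝ} {Z Y : E n × ℝ} (hκ : 1 < κ) (hΔ : 0 < Δ)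
    (h : Good κ Δ T1 Z Y) {x : E n} (hx : ‖x - Y.1‖ ≤ Δ) :
    |hyp κ x Y Z - Z.2| ≤ ‖x - Z.1‖ / Real.sqrt (κ ^ 2 - 1) := by
  have hK : 0 < κ ^ 2 - 1 := by nlinarith
  have h1 := h.G_sq hκ hΔ hx
  have hs : 0 < Real.sqrt (κ ^ 2 - 1) := Real.sqrt_pos.2 hK
  rw [le_div_iff₀ hs]
  have h2 : (κ + 1) / (2 * κ) ≤ 1 := by
    rw [div_le_one (by linarith)]; linarith
  apply abs_le_of_sq_le_sq' _ (norm_nonneg _) |>.2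
  rw [mul_pow, sq_abs, Real.sq_sqrt hK.le]
  nlinarith [sq_nonneg ‖x - Z.1‖]

lemma Good.B_ge {n : ℕ} {κ Δ T1 : ℝ} {Z Y : E n × ℝ} (hκ : 1 < κ) (hΔ : 0 < Δ)
    (h : Good κ Δ T1 Z Y) {x : E n} (hx : ‖x - Y.1‖ ≤ Δ) :
    (κ - 1) / (2 * κ) * ‖x - Z.1‖ ^ 2 ≤
      ‖x - Z.1‖ ^ 2 - (κ ^ 2 - 1) * (hyp κ x Y Z - Z.2) ^ 2 := by
  have h1 := h.G_sq hκ hΔ hx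
  have : (κ - 1) / (2 * κ) + (κ + 1) / (2 * κ) = 1 := by field_simp; ring
  nlinarith [sq_nonneg ‖x - Z.1‖]

lemma hyp_self {n : ℕ} {κ Δ T1 : ℝ} {Z Y : E n × ℝ} (hκ : 1 < κ) (hΔ : 0 < Δ)
    (h : Good κ Δ T1 Z Y) : hyp κ Z.1 Y Z = Z.2 := by
  have hx : ‖Z.1 - Y.1‖ ≤ Δ := by rw [norm_sub_rev]; exact h.1
  have := h.G_sq' hκ hΔ hx
  simp only [sub_self, norm_zero, zero_div] at this
  linarith [abs_nonpos_iff.1 this]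

/-- the gradient -/
def gv {n : ℕ} (κ : ℝ) (Z Y : E n × ℝ) : E n :=
  (1 / ((κ ^ 2 - 1) * rho κ Z Y)) • (Y.1 - Z.1)

lemma gv_inner {n : ℕ} {κ Δ T1 : ℝ} {Z Y : E n × ℝ} (hκ : 1 < κ) (hΔ : 0 < Δ)
    (h : Good κ Δ T1 Z Y) (y : E n) :
    ⟪y, Y.1 - Z.1⟫ = (κ ^ 2 - 1) * rho κ Z Y * ⟪y, gv κ Z Y⟫ := by
  have hK : κ ^ 2 - 1 ≠ 0 := by nlinarith
  have hρ := (h.rho_pos hκ hΔ).ne'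
  unfold gv
  rw [inner_smul_right]
  field_simp

lemma tangent {n : ℕ} {κ Δ T1 : ℝ} {Z Y : E n × ℝ} (hκ : 1 < κ) (hΔ : 0 < Δ)
    (h : Good κ Δ T1 Z Y) (x : E n) :
    2 * (κ ^ 2 - 1) * rho κ Z Y * (⟪x - Z.1, gv κ Z Y⟫ - (hyp κ x Y Z - Z.2))
     = ‖x - Z.1‖ ^ 2 - (κ ^ 2 - 1) * (hyp κ x Y Z - Z.2) ^ 2 := by
  have := quad hκ Z Y x (hyp κ x Y Z - Z.2)
  rw [gv_inner hκ hΔ h] at this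
  linear_combination this

lemma tangent_upper {n : ℕ} {κ Δ T1 : ℝ} {Z Y : E n × ℝ} (hκ : 1 < κ) (hΔ : 0 < Δ)
    (h : Good κ Δ T1 Z Y) {x : E n} (hx : ‖x - Y.1‖ ≤ Δ) :
    hyp κ x Y Z ≤ Z.2 + ⟪x - Z.1, gv κ Z Y⟫ := by
  have hK : 0 < κ ^ 2 - 1 := by nlinarith
  have hρ := (h.rho_pos hκ hΔ)
  have h1 := tangent hκ hΔ h x
  have h2 := h.B_ge hκ hΔ hx
  have h3 : 0 ≤ (κ - 1) / (2 * κ) * ‖x - Z.1‖ ^ 2 := by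
    have : 0 < κ - 1 := by linarith
    positivity
  rw [← h1] at h2
  have := nonneg_of_mul_nonneg_right (h3.trans h2) (by positivity)
  linarith

lemma tangent_lower {n : ℕ} {κ Δ T1 : ℝ} {Z Y : E n × ℝ} (hκ : 1 < κ) (hΔ : 0 < Δ)
    (h : Good κ Δ T1 Z Y) (x : E n) :
    Z.2 + ⟪x - Z.1, gv κ Z Y⟫ - ‖x - Z.1‖ ^ 2 / (2 * κ * Δ) ≤ hyp κ x Y Z := by
  have hK : 0 < κ ^ 2 - 1 := by nlinarith
  have hρ := (h.rho_pos hκ hΔ)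
  have hρ2 := (h.rho_ge hκ hΔ)
  rw [div_le_iff₀ hK] at hρ2
  have h1 := tangent hκ hΔ h x
  have h3 : ⟪x - Z.1, gv κ Z Y⟫ - (hyp κ x Y Z - Z.2) ≤ ‖x - Z.1‖ ^ 2 / (2 * κ * Δ) := by
    rw [le_div_iff₀ (by positivity)]
    by_contra hc
    push Not at hc
    have hpos : 0 < ⟪x - Z.1, gv κ Z Y⟫ - (hyp κ x Y Z - Z.2) := by
      by_contra hcc
      have : 0 < 2 * κ * Δ := by positivity
      nlinarith [sq_nonneg ‖x - Z.1‖]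
    nlinarith [mul_nonneg hK.le (sq_nonneg (hyp κ x Y Z - Z.2)),
      mul_le_mul_of_nonneg_left hρ2 hpos.le]
  linarith


/-! ### Lipschitz dependence -/

lemma pnorm_sub_abs {n : ℕ} (V W : E n × ℝ) : |pnorm V - pnorm W| ≤ pnorm (V - W) := by
  simp only [pnorm_eq, WithLp.toLp_sub]
  exact abs_norm_sub_norm_le _ _

lemma rho_lip {n : ℕ} {κ : ℝ} (hκ : 1 < κ) (Z Y Z' Y' : E n × ℝ) :
    (κ ^ 2 - 1) * |rho κ Z Y - rho κ Z' Y'| ≤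
      (κ + 1) * (pnorm (Y - Y') + pnorm (Z - Z')) := by
  have hK : 0 < κ ^ 2 - 1 := by nlinarith
  have e : (κ ^ 2 - 1) * |rho κ Z Y - rho κ Z' Y'| =
      |κ * (pnorm (Z - Y) - pnorm (Z' - Y')) - ((Y - Y').2 - (Z - Z').2)| := by
    have e0 : (κ ^ 2 - 1) * |rho κ Z Y - rho κ Z' Y'| = |(κ ^ 2 - 1) * (rho κ Z Y - rho κ Z' Y')| := by
      rw [abs_mul, abs_of_pos hK]
    rw [e0]
    congr 1
    unfold rho
    simp only [Prod.snd_sub]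
    field_simp
    ring
  rw [e]
  have h1 := pnorm_sub_abs (Z - Y) (Z' - Y')
  have h2 : pnorm (Z - Y - (Z' - Y')) ≤ pnorm (Y - Y') + pnorm (Z - Z') := by
    have : Z - Y - (Z' - Y') = (-(Y - Y')) + (Z - Z') := by abel
    rw [this]
    refine (pnorm_add_le _ _).trans ?_
    rw [pnorm_neg]
  have h3 := snd_le_pnorm (Y - Y')
  have h4 := snd_le_pnorm (Z - Z')
  rw [abs_le] at h1 h3 h4
  rw [abs_le]
  constructor <;> nlinarith

lemma G_diff {n : ℕ} {κ Δ T1 : ℝ} {Z Y Z' Y' : E n × ℝ} (hκ : 1 < κ) (hΔ : 0 < Δ)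
    (h : Good κ Δ T1 Z Y) (h' : Good κ Δ T1 Z' Y') (hZ : Z.1 = Z'.1) {x : E n}
    (hx : ‖x - Y.1‖ ≤ Δ) (hx' : ‖x - Y'.1‖ ≤ Δ) :
    |(hyp κ x Y Z - Z.2) - (hyp κ x Y' Z' - Z'.2)| ≤
      ((κ + 1) / Δ * (1 / (κ ^ 2 - 1) + (κ + 1) / (κ ^ 2 - 1) / Real.sqrt (κ ^ 2 - 1))) *
        ‖x - Z.1‖ * (pnorm (Y - Y') + pnorm (Z - Z')) := by
  have hK : 0 < κ ^ 2 - 1 := by nlinarith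
  have hκ1 : 0 < κ - 1 := by linarith
  have hs : 0 < Real.sqrt (κ ^ 2 - 1) := Real.sqrt_pos.2 hK
  have q1 := quad hκ Z Y x (hyp κ x Y Z - Z.2)
  have q2 := quad hκ Z' Y' x (hyp κ x Y' Z' - Z'.2)
  have g1 := h.G_sq' hκ hΔ hx
  have g2 := h'.G_sq' hκ hΔ hx'
  have r1 := h.R_ge hκ hΔ x
  have r2 := h'.R_ge hκ hΔ x
  have e1 := hyp_eq hκ Z Y x
  have e2 := hyp_eq hκ Z' Y' x
  have hl := rho_lip hκ Z Y Z' Y'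
  rw [← hZ] at q2 g2
  have hw : ‖(Y.1 - Z.1) - (Y'.1 - Z.1)‖ ≤ pnorm (Y - Y') := by
    have : (Y.1 - Z.1) - (Y'.1 - Z.1) = (Y - Y').1 := by simp
    rw [this]; exact fst_le_pnorm _
  have hi : |⟪x - Z.1, Y.1 - Z.1⟫ - ⟪x - Z.1, Y'.1 - Z.1⟫| ≤ ‖x - Z.1‖ * pnorm (Y - Y') := by
    rw [← inner_sub_right]
    exact (abs_real_inner_le_norm _ _).trans (by gcongr)
  set G := hyp κ x Y Z - Z.2
  set G' := hyp κ x Y' Z' - Z'.2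
  set ρ := rho κ Z Y
  set ρ' := rho κ Z' Y'
  have er : Rr κ Z Y x = ρ - G := by simp only [G]; linarith
  have er' : Rr κ Z' Y' x = ρ' - G' := by simp only [G']; linarith
  rw [er] at r1
  rw [er'] at r2
  set p := pnorm (Y - Y')
  set z := pnorm (Z - Z')
  set N := ‖x - Z.1‖
  have hp : 0 ≤ p := pnorm_nonneg _
  have hz : 0 ≤ z := pnorm_nonneg _
  have hN : 0 ≤ N := norm_nonneg _
  have key : (κ ^ 2 - 1) * (G - G') * ((ρ - G) + (ρ' - G')) =
    2 * (⟪x - Z.1, Y.1 - Z.1⟫ - ⟪x - Z.1, Y'.1 - Z.1⟫) 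
      - ((κ ^ 2 - 1) * (ρ - ρ')) * (G + G') := by
    linear_combination q2 - q1
  have hub : |2 * (⟪x - Z.1, Y.1 - Z.1⟫ - ⟪x - Z.1, Y'.1 - Z.1⟫) 
      - ((κ ^ 2 - 1) * (ρ - ρ')) * (G + G')| ≤ 2 * (N * p) + 
        ((κ + 1) * (p + z)) * (2 * (N / Real.sqrt (κ ^ 2 - 1))) := by
    refine (abs_sub _ _).trans ?_
    rw [abs_mul, abs_mul, abs_two, abs_mul, abs_of_pos hK]
    have : |G + G'| ≤ 2 * (N / Real.sqrt (κ ^ 2 - 1)) := by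
      refine (abs_add_le _ _).trans (by linarith)
    gcongr
  rw [← key, abs_mul, abs_mul, abs_of_pos hK] at hub
  have hD : 2 * ((κ - 1) * Δ / (κ ^ 2 - 1)) ≤ |(ρ - G) + (ρ' - G')| := 
    le_trans (by linarith) (le_abs_self _)
  have hub2 : (κ ^ 2 - 1) * |G - G'| * (2 * ((κ - 1) * Δ / (κ ^ 2 - 1))) ≤ 
      2 * (N * (p + z)) + ((κ + 1) * (p + z)) * (2 * (N / Real.sqrt (κ ^ 2 - 1))) := by
    refine le_trans ?_ (hub.trans ?_)
    · gcongr
    · gcongr; linarith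
  have hfac : 0 < 2 * (κ - 1) * Δ := by positivity
  have e3 : (κ ^ 2 - 1) * |G - G'| * (2 * ((κ - 1) * Δ / (κ ^ 2 - 1))) =
     |G - G'| * (2 * (κ - 1) * Δ) := by field_simp
  rw [e3, ← le_div_iff₀ hfac] at hub2
  refine hub2.trans (le_of_eq ?_)
  have e4 : κ ^ 2 - 1 = (κ - 1) * (κ + 1) := by ring
  have hκ2 : κ + 1 ≠ 0 := by linarith
  have hκ3 : κ - 1 ≠ 0 := hκ1.ne'
  generalize Real.sqrt (κ ^ 2 - 1) = S at *
  rw [e4]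
  have := hs.ne'
  field_simp

lemma gv_lip {n : ℕ} {κ Δ T1 : ℝ} {Z Y Z' Y' : E n × ℝ} (hκ : 1 < κ) (hΔ : 0 < Δ)
    (h : Good κ Δ T1 Z Y) (h' : Good κ Δ T1 Z' Y') :
    ‖gv κ Z Y - gv κ Z' Y'‖ ≤ (1 / (κ * Δ) + Δ * (κ + 1) / (κ * Δ) ^ 2) *
        (pnorm (Y - Y') + pnorm (Z - Z')) := by
  have hK : 0 < κ ^ 2 - 1 := by nlinarith
  have hκ0 : 0 < κ := by linarith
  have hl := rho_lip hκ Z Y Z' Y'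
  have r1 := h.rho_ge hκ hΔ
  have r2 := h'.rho_ge hκ hΔ
  rw [div_le_iff₀ hK] at r1 r2
  unfold gv
  have hkd : 0 < κ * Δ := by positivity
  set a := (κ ^ 2 - 1) * rho κ Z Y with ha
  set a' := (κ ^ 2 - 1) * rho κ Z' Y' with ha'
  have hapos : κ * Δ ≤ a := by linarith
  have hapos' : κ * Δ ≤ a' := by linarith
  have ha0 : 0 < a := by linarith
  have ha0' : 0 < a' := by linarith
  have e : (1 / a) • (Y.1 - Z.1) - (1 / a') • (Y'.1 - Z'.1) =
    (1 / a) • ((Y.1 - Z.1) - (Y'.1 - Z'.1)) + ((a' - a) / (a * a')) • (Y'.1 - Z'.1) := by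
    have : (a' - a) / (a * a') = 1 / a - 1 / a' := by field_simp
    rw [this]; module
  rw [e]
  have hw : ‖(Y.1 - Z.1) - (Y'.1 - Z'.1)‖ ≤ pnorm (Y - Y') + pnorm (Z - Z') := by
    have : (Y.1 - Z.1) - (Y'.1 - Z'.1) = (Y - Y').1 - (Z - Z').1 := by simp; abel
    rw [this]
    exact (norm_sub_le _ _).trans (add_le_add (fst_le_pnorm _) (fst_le_pnorm _))
  have hda : |a' - a| ≤ (κ + 1) * (pnorm (Y - Y') + pnorm (Z - Z')) := by
    rw [ha, ha', ← mul_sub, abs_mul, abs_of_pos hK, abs_sub_comm]; exact hl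
  have hP : 0 ≤ pnorm (Y - Y') + pnorm (Z - Z') := add_nonneg (pnorm_nonneg _) (pnorm_nonneg _)
  set P := pnorm (Y - Y') + pnorm (Z - Z')
  refine (norm_add_le _ _).trans ?_
  rw [norm_smul, norm_smul, Real.norm_eq_abs, Real.norm_eq_abs,
    abs_of_pos (by positivity : 0 < 1 / a), abs_div, abs_of_pos (by positivity : 0 < a * a')]
  have t1 : 1 / a * ‖(Y.1 - Z.1) - (Y'.1 - Z'.1)‖ ≤ 1 / (κ * Δ) * P := by gcongr
  have t2 : |a' - a| / (a * a') * ‖Y'.1 - Z'.1‖ ≤ ((κ + 1) * P) / ((κ * Δ) * (κ * Δ)) * Δ := by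
    have := h'.1
    gcongr
  refine (add_le_add t1 t2).trans (le_of_eq ?_)
  field_simp

/-- characterisation of being above the hyperboloid by means of `c`. -/
lemma hypb_le_iff {n : ℕ} {κ : ℝ} (hκ : 1 < κ) (Y : E n × ℝ) (x : E n) (t : ℝ) {b : ℝ}
    (hb : 0 < b) : hypb κ Y b x ≤ t ↔ cfun κ (x, t) Y ≤ b := by
  have hK : 0 < κ ^ 2 - 1 := by nlinarith
  unfold hypb cfun pnorm
  simp only [Prod.fst_sub, Prod.snd_sub]
  set r := ‖x - Y.1‖ with hr
  have e1 : Real.sqrt (b ^ 2 / (κ ^ 2 - 1) ^ 2 + r ^ 2 / (κ ^ 2 - 1)) =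
    Real.sqrt (b ^ 2 + (κ ^ 2 - 1) * r ^ 2) / (κ ^ 2 - 1) := by
    rw [← Real.sqrt_sq hK.le, ← Real.sqrt_div' _ (by positivity), Real.sqrt_sq hK.le]
    congr 1
    field_simp
  rw [e1]
  set T := Y.2 - t with hT
  have e2 : t - Y.2 = - T := by rw [hT]; ring
  rw [e2, neg_sq]
  have l1 : (Y.2 - κ * b / (κ ^ 2 - 1) - Real.sqrt (b ^ 2 + (κ ^ 2 - 1) * r ^ 2) / (κ ^ 2 - 1) ≤ t)
    ↔ (κ ^ 2 - 1) * T - κ * b ≤ Real.sqrt (b ^ 2 + (κ ^ 2 - 1) * r ^ 2) := by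
    have : Y.2 - κ * b / (κ ^ 2 - 1) - Real.sqrt (b ^ 2 + (κ ^ 2 - 1) * r ^ 2) / (κ ^ 2 - 1) - t =
     ((κ ^ 2 - 1) * T - κ * b - Real.sqrt (b ^ 2 + (κ ^ 2 - 1) * r ^ 2)) / (κ ^ 2 - 1) := by
      rw [hT]; field_simp; ring
    rw [← sub_nonpos, this, div_le_iff₀ hK, zero_mul, sub_nonpos]
  rw [l1]
  have l2 : (κ * T - Real.sqrt (r ^ 2 + T ^ 2) ≤ b) ↔ κ * T - b ≤ Real.sqrt (r ^ 2 + T ^ 2) := by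
    constructor <;> intro h <;> linarith
  rw [l2]
  have hs1 := Real.sq_sqrt (by positivity : 0 ≤ b ^ 2 + (κ ^ 2 - 1) * r ^ 2)
  have hs2 := Real.sq_sqrt (by positivity : 0 ≤ r ^ 2 + T ^ 2)
  have hs1' := Real.sqrt_nonneg (b ^ 2 + (κ ^ 2 - 1) * r ^ 2)
  have hs2' := Real.sqrt_nonneg (r ^ 2 + T ^ 2)
  have hbs : b ≤ Real.sqrt (b ^ 2 + (κ ^ 2 - 1) * r ^ 2) := by
    apply Real.le_sqrt_of_sq_le
    have : 0 ≤ (κ ^ 2 - 1) * r ^ 2 := by positivity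
    linarith
  by_cases hc : κ * T ≤ b
  · have hT1 : (κ ^ 2 - 1) * T - κ * b ≤ Real.sqrt (b ^ 2 + (κ ^ 2 - 1) * r ^ 2) := by
      have : (κ ^ 2 - 1) * T ≤ κ * b := by
        by_cases hT0 : T ≤ 0
        · nlinarith
        · nlinarith
      linarith
    exact ⟨fun _ => by linarith, fun _ => hT1⟩
  · push Not at hc
    constructor
    · intro h
      apply Real.le_sqrt_of_sq_le
      have h' : ((κ ^ 2 - 1) * T - κ * b) ^ 2 ≤ b ^ 2 + (κ ^ 2 - 1) * r ^ 2 := by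
        rw [← hs1]
        apply sq_le_sq'
        · have : -b ≤ (κ ^ 2 - 1) * T - κ * b := by
            have h1 : (κ ^ 2 - 1) * b ≤ (κ ^ 2 - 1) * (κ * T) := by gcongr
            nlinarith
          linarith
        · exact h
      have : 0 ≤ (κ ^ 2 - 1) * (r ^ 2 + T ^ 2 - (κ * T - b) ^ 2) := by nlinarith
      nlinarith [nonneg_of_mul_nonneg_right this hK]
    · intro h
      apply Real.le_sqrt_of_sq_le
      have h' : (κ * T - b) ^ 2 ≤ r ^ 2 + T ^ 2 := by
        rw [← hs2]
        apply sq_le_sq' <;> linarith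
      nlinarith [mul_le_mul_of_nonneg_left h' hK.le]

/-- the function `t ↦ c((x,t),Y)` is strictly decreasing -/
lemma cfun_anti {n : ℕ} {κ : ℝ} (hκ : 1 < κ) (Y : E n × ℝ) (x : E n) {t t' : ℝ} (h : t < t') :
    cfun κ (x, t') Y < cfun κ (x, t) Y := by
  unfold cfun
  have h1 := pnorm_sub_abs ((x, t) - Y) ((x, t') - Y)
  have e : (x, t) - Y - ((x, t') - Y) = ((0 : E n), t - t') := by
    ext1 <;> simp
  rw [e] at h1
  have e2 : pnorm ((0 : E n), t - t') = t' - t := by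
    unfold pnorm
    simp only [norm_zero]
    rw [show (0:ℝ) ^ 2 + (t - t') ^ 2 = (t' - t) ^ 2 by ring, Real.sqrt_sq (by linarith)]
  rw [e2] at h1
  have := (abs_le.1 h1).2
  simp only
  nlinarith

lemma hypb_eq_iff {n : ℕ} {κ : ℝ} (hκ : 1 < κ) (Y : E n × ℝ) (x : E n) (t : ℝ) {b : ℝ}
    (hb : 0 < b) : hypb κ Y b x = t ↔ cfun κ (x, t) Y = b := by
  have key : cfun κ (x, hypb κ Y b x) Y = b := by
    have h1 := (hypb_le_iff hκ Y x (hypb κ Y b x) hb).1 le_rfl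
    by_contra hne
    have hlt : cfun κ (x, hypb κ Y b x) Y < b := lt_of_le_of_ne h1 hne
    have hcont : Continuous (fun t : ℝ => cfun κ (x, t) Y) := by
      unfold cfun pnorm; fun_prop
    have hev : ∀ᶠ t in nhds (hypb κ Y b x), cfun κ (x, t) Y < b :=
      hcont.continuousAt.eventually (gt_mem_nhds hlt)
    obtain ⟨ε, hε, hball⟩ := Metric.eventually_nhds_iff.1 hev
    have := @hball (hypb κ Y b x - ε / 2) (by
      rw [Real.dist_eq]; simp only [sub_sub_cancel_left, abs_neg]; rw [abs_of_pos] <;> linarith)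
    have := (hypb_le_iff hκ Y x _ hb).2 this.le
    linarith
  constructor
  · intro h; rw [← h]; exact key
  · intro h
    rcases lt_trichotomy (hypb κ Y b x) t with h1 | h1 | h1
    · have := cfun_anti hκ Y x h1; linarith
    · exact h1
    · have := cfun_anti hκ Y x h1; linarith

lemma hypb_lt_iff {n : ℕ} {κ : ℝ} (hκ : 1 < κ) (Y : E n × ℝ) (x : E n) (t : ℝ) {b : ℝ}
    (hb : 0 < b) : hypb κ Y b x < t ↔ cfun κ (x, t) Y < b := by
  rw [lt_iff_le_and_ne, lt_iff_le_and_ne, hypb_le_iff hκ Y x t hb, Ne, Ne,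
    hypb_eq_iff hκ Y x t hb]

/-- hyperboloid through a point of itself -/
lemma hyp_rebase {n : ℕ} {κ : ℝ} (hκ : 1 < κ) (Y X : E n × ℝ) (x : E n)
    (hb : 0 < cfun κ X Y) (y : E n) :
    hyp κ y Y (x, hyp κ x Y X) = hyp κ y Y X := by
  have : cfun κ (x, hyp κ x Y X) Y = cfun κ X Y :=
    (hypb_eq_iff hκ Y x (hyp κ x Y X) hb).1 rfl
  unfold hyp at *
  rw [this]

/-! ### Gradients -/

lemma hasGradientAt_of_bound {n : ℕ} {f : E n → ℝ} {z v : E n} {C a : ℝ} (ha : 0 < a)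
    (h : ∀ᶠ x in nhds z, |f x - f z - ⟪x - z, v⟫| ≤ C * ‖x - z‖ ^ a * ‖x - z‖) :
    HasGradientAt f v z := by
  rw [hasGradientAt_iff_isLittleO]
  rw [Asymptotics.isLittleO_iff]
  intro c hc
  have hlim : Filter.Tendsto (fun x : E n => C * ‖x - z‖ ^ a) (nhds z) (nhds 0) := by
    have hcont : ContinuousAt (fun x : E n => C * ‖x - z‖ ^ a) z := by
      apply ContinuousAt.mul continuousAt_const
      apply ContinuousAt.rpow_const (by fun_prop)
      right; exact ha.le
    have := hcont.tendsto
    simpa [Real.zero_rpow ha.ne'] using this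
  filter_upwards [h, hlim.eventually (gt_mem_nhds hc)] with x h1 h2
  rw [Real.norm_eq_abs, real_inner_comm]
  exact h1.trans (by gcongr)

lemma hyp_grad {n : ℕ} {κ Δ T1 : ℝ} {Z Y : E n × ℝ} (hκ : 1 < κ) (hΔ : 0 < Δ)
    (h : Good κ Δ T1 Z Y) (hx : ∀ᶠ x in nhds Z.1, ‖x - Y.1‖ ≤ Δ) :
    HasGradientAt (fun z => hyp κ z Y Z) (gv κ Z Y) Z.1 := by
  apply hasGradientAt_of_bound (C := 1 / (2 * κ * Δ)) (a := 1) one_pos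
  filter_upwards [hx] with x hx
  have h1 := tangent_upper hκ hΔ h hx
  have h2 := tangent_lower hκ hΔ h x
  rw [hyp_self hκ hΔ h, Real.rpow_one]
  have e : 1 / (2 * κ * Δ) * ‖x - Z.1‖ * ‖x - Z.1‖ = ‖x - Z.1‖ ^ 2 / (2 * κ * Δ) := by ring
  have : 0 ≤ ‖x - Z.1‖ ^ 2 / (2 * κ * Δ) := by positivity
  rw [e, abs_le]
  constructor <;> linarith


/-! ### Local to global for `n ≥ 2` -/

lemma G_le_rho {n : ℕ} {κ Δ T1 : ℝ} {Z Y : E n × ℝ} (hκ : 1 < κ) (hΔ : 0 < Δ)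
    (h : Good κ Δ T1 Z Y) {x : E n} (hx : ‖x - Y.1‖ ≤ Δ) (hxz : ‖x - Z.1‖ ≤ Δ) :
    |hyp κ x Y Z - Z.2| ≤ κ * Δ / (κ ^ 2 - 1) := by
  have hK : 0 < κ ^ 2 - 1 := by nlinarith
  have h1 := h.G_sq' hκ hΔ hx
  have hs : 0 < Real.sqrt (κ ^ 2 - 1) := Real.sqrt_pos.2 hK
  have hs2 := Real.sq_sqrt hK.le
  have hs3 : Real.sqrt (κ ^ 2 - 1) ≤ κ := by
    rw [Real.sqrt_le_left (by linarith)]; linarith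
  refine h1.trans ?_
  rw [div_le_div_iff₀ hs hK]
  calc ‖x - Z.1‖ * (κ ^ 2 - 1) ≤ Δ * (κ ^ 2 - 1) := by gcongr
    _ = Δ * (Real.sqrt (κ ^ 2 - 1) * Real.sqrt (κ ^ 2 - 1)) := by rw [← sq, hs2]
    _ ≤ Δ * (κ * Real.sqrt (κ ^ 2 - 1)) := by gcongr
    _ = _ := by ring

lemma hyp_cont {n : ℕ} (κ : ℝ) (Y Z : E n × ℝ) : Continuous (fun x => hyp κ x Y Z) := by
  unfold hyp hypb
  fun_prop

lemma mem_segment_of_le_max {n : ℕ} {a b w : E n}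
    (h : ∀ y : E n, ⟪y, w⟫ ≤ max ⟪y, a⟫ ⟪y, b⟫) :
    ∃ l : ℝ, 0 ≤ l ∧ l ≤ 1 ∧ w = (1 - l) • a + l • b := by
  have hw : w ∈ segment ℝ a b := by
    by_contra hc
    have hcl : IsClosed (segment ℝ a b) := by
      rw [← convexHull_pair]
      exact ((Set.toFinite ({a, b} : Set (E n))).isCompact_convexHull ℝ).isClosed
    obtain ⟨f, s, h1, h2⟩ := geometric_hahn_banach_closed_point (convex_segment a b) hcl hc
    have hf := fun x => InnerProductSpace.toDual_symm_apply (𝕜 := ℝ) (x := x) (y := f)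
    have := h ((InnerProductSpace.toDual ℝ (E n)).symm f)
    rw [hf, hf, hf] at this
    have ha := h1 a (left_mem_segment ℝ a b)
    have hb := h1 b (right_mem_segment ℝ a b)
    have := max_lt ha hb
    linarith
  obtain ⟨p, l, hp, hl, hpl, e⟩ := hw
  exact ⟨l, hl, by linarith, by rw [← e]; congr 2; linarith⟩

lemma glob_step2 {n : ℕ} {κ Δ T1 A g₀ γ : ℝ} {Z W : E n × ℝ} (hκ : 1 < κ) (hΔ : 0 < Δ)
    (hW : Good κ Δ T1 Z W) {x : E n}
    (hg : |g₀| ≤ κ * Δ / (κ ^ 2 - 1))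
    (hA : 0 ≤ A)
    (hB : 0 < ‖x - Z.1‖ ^ 2 - (κ ^ 2 - 1) * g₀ ^ 2)
    (hloc : hyp κ x W Z - Z.2 ≤ g₀ - A * ‖x - Z.1‖ ^ 2)
    (hL : 2 * ⟪x - Z.1, W.1 - Z.1⟫ - 2 * (κ ^ 2 - 1) * rho κ Z W * g₀ =
      γ * (‖x - Z.1‖ ^ 2 - (κ ^ 2 - 1) * g₀ ^ 2)) :
    γ ≤ 1 - A * ((κ - 1) * Δ) := by
  have hK : 0 < κ ^ 2 - 1 := by nlinarith
  have hκ1 : 0 < κ - 1 := by linarith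
  have hq := quad hκ Z W x g₀
  rw [hL] at hq
  have hR := hW.R_ge hκ hΔ x
  have hρ := hW.rho_ge hκ hΔ
  have hg2 := (abs_le.1 hg).2
  have hfac : (κ - 1) * Δ / (κ ^ 2 - 1) ≤ rho κ Z W - g₀ + Rr κ Z W x := by linarith
  have hfac' : (κ - 1) * Δ ≤ (κ ^ 2 - 1) * (rho κ Z W - g₀ + Rr κ Z W x) := by
    rw [div_le_iff₀ hK] at hfac; linarith
  set B := ‖x - Z.1‖ ^ 2 - (κ ^ 2 - 1) * g₀ ^ 2 with hBdef
  have hBle : B ≤ ‖x - Z.1‖ ^ 2 := by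
    have : 0 ≤ (κ ^ 2 - 1) * g₀ ^ 2 := by positivity
    linarith
  have h1 : A * B * ((κ - 1) * Δ) ≤ (1 - γ) * B := by
    calc A * B * ((κ - 1) * Δ) ≤ (g₀ - (hyp κ x W Z - Z.2)) *
          ((κ ^ 2 - 1) * (rho κ Z W - g₀ + Rr κ Z W x)) := by
          gcongr
          · nlinarith [mul_le_mul_of_nonneg_left hBle hA, sq_nonneg ‖x - Z.1‖]
          · nlinarith [mul_le_mul_of_nonneg_left hBle hA]
      _ = (1 - γ) * B := by linear_combination hq
  have : (A * ((κ - 1) * Δ)) * B ≤ (1 - γ) * B := by linarith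
  have := le_of_mul_le_mul_right this hB
  linarith

set_option maxHeartbeats 2000000 in
lemma glob_gap {n : ℕ} (hn : 2 ≤ n) {κ Δ T1 A r : ℝ} {Z Yb Yh W : E n × ℝ}
    (hκ : 1 < κ) (hΔ : 0 < Δ) (hT1 : 0 < T1)
    (hYb : Good κ Δ T1 Z Yb) (hYh : Good κ Δ T1 Z Yh) (hW : Good κ Δ T1 Z W)
    (S : Set (E n)) (hS : ∀ x ∈ S, ‖x - Yb.1‖ ≤ Δ ∧ ‖x - Yh.1‖ ≤ Δ ∧ ‖x - W.1‖ ≤ Δ ∧ ‖x - Z.1‖ ≤ Δ)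
    (hr : 0 < r) (hA : 0 < A)
    (hloc : ∀ x, ‖x - Z.1‖ ≤ r → x ∈ S ∧
      hyp κ x W Z ≤ max (hyp κ x Yb Z) (hyp κ x Yh Z) - A * ‖x - Z.1‖ ^ 2) :
    ∀ x ∈ S, hyp κ x W Z ≤ max (hyp κ x Yb Z) (hyp κ x Yh Z) -
      ((κ - 1) * Δ * ((κ - 1) / (2 * κ)) / (4 * κ * (T1 + Δ))) * A * ‖x - Z.1‖ ^ 2 := by
  have hK : 0 < κ ^ 2 - 1 := by nlinarith
  have hκ1 : 0 < κ - 1 := by linarith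
  have hκ0 : 0 < κ := by linarith
  -- Step 1
  have step1 : ∀ y : E n, ⟪y, gv κ Z W⟫ ≤ max ⟪y, gv κ Z Yb⟫ ⟪y, gv κ Z Yh⟫ := by
    intro y
    by_contra hc
    push Not at hc
    set m := max ⟪y, gv κ Z Yb⟫ ⟪y, gv κ Z Yh⟫
    set q := ⟪y, gv κ Z W⟫
    have hev : ∀ ε : ℝ, 0 < ε → ε * ‖y‖ ≤ r → q - m ≤ ε * (‖y‖ ^ 2 / (2 * κ * Δ)) := by
      intro ε hε hεr
      have hx : ‖(Z.1 + ε • y) - Z.1‖ = ε * ‖y‖ := by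
        rw [add_sub_cancel_left, norm_smul, Real.norm_eq_abs, abs_of_pos hε]
      obtain ⟨hxS, hl⟩ := hloc (Z.1 + ε • y) (by rw [hx]; exact hεr)
      obtain ⟨s1, s2, s3, s4⟩ := hS _ hxS
      have t1 := tangent_upper hκ hΔ hYb s1
      have t2 := tangent_upper hκ hΔ hYh s2
      have t3 := tangent_lower hκ hΔ hW (Z.1 + ε • y)
      rw [hx] at t3
      simp only [add_sub_cancel_left, real_inner_smul_left] at t1 t2 t3
      have hm1 : ⟪y, gv κ Z Yb⟫ ≤ m := le_max_left _ _
      have hm2 : ⟪y, gv κ Z Yh⟫ ≤ m := le_max_right _ _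
      have hmx : max (hyp κ (Z.1 + ε • y) Yb Z) (hyp κ (Z.1 + ε • y) Yh Z) ≤ Z.2 + ε * m := by
        apply max_le
        · nlinarith
        · nlinarith
      have hAx : 0 ≤ A * ‖(Z.1 + ε • y) - Z.1‖ ^ 2 := by positivity
      have : ε * (q - m) ≤ ε * (ε * (‖y‖ ^ 2 / (2 * κ * Δ))) := by
        have e : ε * (ε * (‖y‖ ^ 2 / (2 * κ * Δ))) = (ε * ‖y‖) ^ 2 / (2 * κ * Δ) := by ring
        rw [e]
        change Z.2 + ε * q - _ ≤ _ at t3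
        linarith
      exact le_of_mul_le_mul_left this hε
    have hlim : Filter.Tendsto (fun ε : ℝ => ε * (‖y‖ ^ 2 / (2 * κ * Δ))) (nhdsWithin 0 (Set.Ioi 0))
        (nhds 0) := by
      have : Filter.Tendsto (fun ε : ℝ => ε * (‖y‖ ^ 2 / (2 * κ * Δ))) (nhds 0)
        (nhds (0 * (‖y‖ ^ 2 / (2 * κ * Δ)))) := (continuous_id.mul continuous_const).tendsto 0
      rw [zero_mul] at this
      exact this.mono_left nhdsWithin_le_nhds
    have hlim2 : ∀ᶠ ε : ℝ in nhdsWithin 0 (Set.Ioi 0), ε * ‖y‖ ≤ r := by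
      have : Filter.Tendsto (fun ε : ℝ => ε * ‖y‖) (nhds 0)
        (nhds (0 * ‖y‖)) := (continuous_id.mul continuous_const).tendsto 0
      rw [zero_mul] at this
      exact ((this.mono_left nhdsWithin_le_nhds).eventually (gt_mem_nhds hr)).mono
        (fun _ h => le_of_lt h)
    have := ge_of_tendsto hlim (b := q - m) (by
      filter_upwards [hlim2, self_mem_nhdsWithin] with ε h1 h2
      exact hev ε h2 h1)
    linarith
  obtain ⟨l, hl0, hl1, hl⟩ := mem_segment_of_le_max step1
  have hρb := hYb.rho_pos hκ hΔ
  have hρh := hYh.rho_pos hκ hΔ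
  have hρw := hW.rho_pos hκ hΔ
  -- Step 2
  have step2 : ∃ α β : ℝ, 0 ≤ α ∧ 0 ≤ β ∧ α + β ≤ 1 - A * ((κ - 1) * Δ) ∧ ∀ (y : E n) (g : ℝ),
      2 * ⟪y, W.1 - Z.1⟫ - 2 * (κ ^ 2 - 1) * rho κ Z W * g =
      α * (2 * ⟪y, Yb.1 - Z.1⟫ - 2 * (κ ^ 2 - 1) * rho κ Z Yb * g) +
      β * (2 * ⟪y, Yh.1 - Z.1⟫ - 2 * (κ ^ 2 - 1) * rho κ Z Yh * g) := by
    have hbB : ∀ x, ‖x - Z.1‖ ≤ r → 0 < ‖x - Z.1‖ → 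
        0 < ‖x - Z.1‖ ^ 2 - (κ ^ 2 - 1) * (hyp κ x Yb Z - Z.2) ^ 2 := by
      intro x hx hx0
      refine lt_of_lt_of_le ?_ (hYb.B_ge hκ hΔ (hS x (hloc x hx).1).1)
      positivity
    have hbH : ∀ x, ‖x - Z.1‖ ≤ r → 0 < ‖x - Z.1‖ → 
        0 < ‖x - Z.1‖ ^ 2 - (κ ^ 2 - 1) * (hyp κ x Yh Z - Z.2) ^ 2 := by
      intro x hx hx0
      refine lt_of_lt_of_le ?_ (hYh.B_ge hκ hΔ (hS x (hloc x hx).1).2.1)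
      positivity
    have Lb : ∀ x, 2 * ⟪x - Z.1, Yb.1 - Z.1⟫ - 2 * (κ ^ 2 - 1) * rho κ Z Yb * (hyp κ x Yb Z - Z.2) = 
        ‖x - Z.1‖ ^ 2 - (κ ^ 2 - 1) * (hyp κ x Yb Z - Z.2) ^ 2 := by
      intro x
      have := quad hκ Z Yb x (hyp κ x Yb Z - Z.2)
      linear_combination this
    have Lh : ∀ x, 2 * ⟪x - Z.1, Yh.1 - Z.1⟫ - 2 * (κ ^ 2 - 1) * rho κ Z Yh * (hyp κ x Yh Z - Z.2) = 
        ‖x - Z.1‖ ^ 2 - (κ ^ 2 - 1) * (hyp κ x Yh Z - Z.2) ^ 2 := by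
      intro x
      have := quad hκ Z Yh x (hyp κ x Yh Z - Z.2)
      linear_combination this
    have hrank : 1 < Module.rank ℝ (E n) := by
      rw [← Module.finrank_eq_rank, finrank_euclideanSpace_fin]
      exact_mod_cast hn
    by_cases hv : gv κ Z Yb = gv κ Z Yh
    · -- degenerate case
      have hvW : gv κ Z W = gv κ Z Yh := by
        rw [hl, hv]; module
      obtain ⟨x, hx⟩ : ∃ x, x ∈ Metric.sphere Z.1 r := by
        have := isConnected_sphere hrank Z.1 hr.le
        exact this.nonempty
      rw [mem_sphere_iff_norm] at hx
      obtain ⟨hxS, hlx⟩ := hloc x hx.le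
      obtain ⟨s1, s2, s3, s4⟩ := hS x hxS
      rcases le_total (hyp κ x Yb Z) (hyp κ x Yh Z) with hle | hle
      · rw [max_eq_right hle] at hlx
        have hall : ∀ (y : E n) (g : ℝ),
          2 * ⟪y, W.1 - Z.1⟫ - 2 * (κ ^ 2 - 1) * rho κ Z W * g =
          (rho κ Z W / rho κ Z Yh) * (2 * ⟪y, Yh.1 - Z.1⟫ - 2 * (κ ^ 2 - 1) * rho κ Z Yh * g) := by
          intro y g
          rw [gv_inner hκ hΔ hW, gv_inner hκ hΔ hYh, hvW]
          field_simp
        refine ⟨0, rho κ Z W / rho κ Z Yh, le_rfl, by positivity, ?_, ?_⟩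
        · rw [zero_add]
          apply glob_step2 hκ hΔ hW (G_le_rho hκ hΔ hYh s2 s4) hA.le
            (hbH x hx.le (by rw [hx]; exact hr)) (by linarith)
          rw [hall, Lh]
        · intro y g
          rw [hall]; ring
      · rw [max_eq_left hle] at hlx
        have hall : ∀ (y : E n) (g : ℝ),
          2 * ⟪y, W.1 - Z.1⟫ - 2 * (κ ^ 2 - 1) * rho κ Z W * g =
          (rho κ Z W / rho κ Z Yb) * (2 * ⟪y, Yb.1 - Z.1⟫ - 2 * (κ ^ 2 - 1) * rho κ Z Yb * g) := by
          intro y g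
          rw [gv_inner hκ hΔ hW, gv_inner hκ hΔ hYb, hvW, hv]
          field_simp
        refine ⟨rho κ Z W / rho κ Z Yb, 0, by positivity, le_rfl, ?_, ?_⟩
        · rw [add_zero]
          apply glob_step2 hκ hΔ hW (G_le_rho hκ hΔ hYb s1 s4) hA.le
            (hbB x hx.le (by rw [hx]; exact hr)) (by linarith)
          rw [hall, Lb]
        · intro y g
          rw [hall]; ring
    · -- nondegenerate case: find a point on a sphere where the two hyperboloids meet
      set a := gv κ Z Yb - gv κ Z Yh with ha
      have ha0 : 0 < ‖a‖ := by rw [norm_pos_iff, ha]; exact sub_ne_zero.2 hv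
      obtain ⟨r', hr'0, hr'r, hr'a⟩ : ∃ r' : ℝ, 0 < r' ∧ r' ≤ r ∧ r' / (2 * κ * Δ) ≤ ‖a‖ := by
        refine ⟨min r (‖a‖ * (2 * κ * Δ)), lt_min hr (by positivity), min_le_left _ _, ?_⟩
        rw [div_le_iff₀ (by positivity)]
        exact min_le_right _ _
      have hnorm : ‖(r' / ‖a‖) • a‖ = r' := by
        rw [norm_smul, Real.norm_eq_abs, abs_of_pos (by positivity)]
        field_simp
      have hin : ⟪(r' / ‖a‖) • a, a⟫ = r' * ‖a‖ := by
        rw [real_inner_smul_left, real_inner_self_eq_norm_sq]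
        field_simp
      have hin' : ⟪(r' / ‖a‖) • a, gv κ Z Yb⟫ - ⟪(r' / ‖a‖) • a, gv κ Z Yh⟫ = r' * ‖a‖ := by
        rw [← inner_sub_right, ← ha, hin]
      have hr2 : r' ^ 2 / (2 * κ * Δ) ≤ r' * ‖a‖ := by
        have : r' ^ 2 / (2 * κ * Δ) = r' * (r' / (2 * κ * Δ)) := by ring
        rw [this]; gcongr
      have hpt1 : hyp κ (Z.1 + (r' / ‖a‖) • a) Yh Z ≤ hyp κ (Z.1 + (r' / ‖a‖) • a) Yb Z := by
        have hmem := (hloc (Z.1 + (r' / ‖a‖) • a) (by rw [add_sub_cancel_left, hnorm]; exact hr'r)).1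
        have t1 := tangent_upper hκ hΔ hYh (hS _ hmem).2.1
        have t2 := tangent_lower hκ hΔ hYb (Z.1 + (r' / ‖a‖) • a)
        rw [add_sub_cancel_left] at t1 t2
        rw [hnorm] at t2
        linarith
      have hpt2 : hyp κ (Z.1 + -((r' / ‖a‖) • a)) Yb Z ≤ hyp κ (Z.1 + -((r' / ‖a‖) • a)) Yh Z := by
        have hmem := (hloc (Z.1 + -((r' / ‖a‖) • a))
          (by rw [add_sub_cancel_left, norm_neg, hnorm]; exact hr'r)).1
        have t1 := tangent_upper hκ hΔ hYb (hS _ hmem).1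
        have t2 := tangent_lower hκ hΔ hYh (Z.1 + -((r' / ‖a‖) • a))
        rw [add_sub_cancel_left, inner_neg_left] at t1 t2
        rw [norm_neg, hnorm] at t2
        linarith
      have hconn := (isConnected_sphere hrank Z.1 hr'0.le).isPreconnected
      obtain ⟨x, hx, hxe⟩ := hconn.intermediate_value₂ (f := fun x => hyp κ x Yh Z)
        (g := fun x => hyp κ x Yb Z)
        (a := Z.1 + (r' / ‖a‖) • a) (b := Z.1 + -((r' / ‖a‖) • a))
        (by rw [mem_sphere_iff_norm, add_sub_cancel_left, hnorm])
        (by rw [mem_sphere_iff_norm, add_sub_cancel_left, norm_neg, hnorm])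
        (hyp_cont κ Yh Z).continuousOn (hyp_cont κ Yb Z).continuousOn hpt1 hpt2
      rw [mem_sphere_iff_norm] at hx
      obtain ⟨hxS, hlx⟩ := hloc x (by rw [hx]; exact hr'r)
      obtain ⟨s1, s2, s3, s4⟩ := hS x hxS
      rw [hxe, max_self] at hlx
      have hall : ∀ (y : E n) (g : ℝ),
          2 * ⟪y, W.1 - Z.1⟫ - 2 * (κ ^ 2 - 1) * rho κ Z W * g =
          (rho κ Z W * (1 - l) / rho κ Z Yb) *
            (2 * ⟪y, Yb.1 - Z.1⟫ - 2 * (κ ^ 2 - 1) * rho κ Z Yb * g) + 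
          (rho κ Z W * l / rho κ Z Yh) *
            (2 * ⟪y, Yh.1 - Z.1⟫ - 2 * (κ ^ 2 - 1) * rho κ Z Yh * g) := by
        intro y g
        rw [gv_inner hκ hΔ hW, gv_inner hκ hΔ hYb, gv_inner hκ hΔ hYh, hl, inner_add_right,
          inner_smul_right, inner_smul_right]
        field_simp
        ring
      have hl1' : 0 ≤ 1 - l := by linarith
      refine ⟨_, _, by positivity, by positivity, ?_, hall⟩
      apply glob_step2 hκ hΔ hW (G_le_rho hκ hΔ hYb s1 s4) hA.le
            (hbB x (by rw [hx]; exact hr'r) (by rw [hx]; exact hr'0)) (by linarith)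
      rw [hall, Lb]
      have := Lh x
      rw [hxe] at this
      rw [this]; ring
  obtain ⟨α, β, hα, hβ, hαβ, hall⟩ := step2
  -- Step 3
  intro x hxS
  obtain ⟨s1, s2, s3, s4⟩ := hS x hxS
  by_cases hx0 : ‖x - Z.1‖ = 0
  · have hxz : x = Z.1 := by rwa [norm_eq_zero, sub_eq_zero] at hx0
    rw [hx0, hxz, hyp_self hκ hΔ hW, hyp_self hκ hΔ hYb, hyp_self hκ hΔ hYh]
    simp
  have hxpos : 0 < ‖x - Z.1‖ := lt_of_le_of_ne (norm_nonneg _) (Ne.symm hx0)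
  have hB := hW.B_ge hκ hΔ s3
  have hLW : 2 * ⟪x - Z.1, W.1 - Z.1⟫ - 2 * (κ ^ 2 - 1) * rho κ Z W * (hyp κ x W Z - Z.2) = 
        ‖x - Z.1‖ ^ 2 - (κ ^ 2 - 1) * (hyp κ x W Z - Z.2) ^ 2 := by
    have := quad hκ Z W x (hyp κ x W Z - Z.2)
    linear_combination this
  rw [hall] at hLW
  have hGW := abs_le.1 (G_le_rho hκ hΔ hW s3 s4)
  set gW := hyp κ x W Z - Z.2 with hgW
  set B := ‖x - Z.1‖ ^ 2 - (κ ^ 2 - 1) * gW ^ 2 with hBdef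
  have hcB : 0 < (κ - 1) / (2 * κ) * ‖x - Z.1‖ ^ 2 := by positivity
  have hBpos : 0 < B := lt_of_lt_of_le hcB hB
  set c := A * ((κ - 1) * Δ) with hc
  have hcpos : 0 < c := by positivity
  have fin : ∀ Y : E n × ℝ, Good κ Δ T1 Z Y → ‖x - Y.1‖ ≤ Δ →
      (1 + c) * B ≤ 2 * ⟪x - Z.1, Y.1 - Z.1⟫ - 2 * (κ ^ 2 - 1) * rho κ Z Y * gW →
      ((κ - 1) * Δ * ((κ - 1) / (2 * κ)) / (4 * κ * (T1 + Δ))) * A * ‖x - Z.1‖ ^ 2 ≤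
        hyp κ x Y Z - hyp κ x W Z := by
    intro Y hY hxY hge
    have hq := quad hκ Z Y x gW
    rw [← hBdef] at hq
    have hρ1 := hY.rho_le hκ hΔ
    have hρ2 := hY.rho_ge hκ hΔ
    have hR := hY.R_pos hκ hΔ x
    have hGY := abs_le.1 (G_le_rho hκ hΔ hY hxY s4)
    have he := hyp_eq hκ Z Y x
    have hle : (κ ^ 2 - 1) * (rho κ Z Y - gW + Rr κ Z Y x) ≤ 4 * κ * (T1 + Δ) := by
      have h1 : κ * Δ / (κ ^ 2 - 1) ≤ κ * (T1 + Δ) / (κ ^ 2 - 1) := by gcongr; linarith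
      have : rho κ Z Y - gW + Rr κ Z Y x ≤ 4 * (κ * (T1 + Δ) / (κ ^ 2 - 1)) := by linarith
      calc _ ≤ (κ ^ 2 - 1) * (4 * (κ * (T1 + Δ) / (κ ^ 2 - 1))) := by gcongr
        _ = _ := by field_simp
    have hpos : 0 < (κ ^ 2 - 1) * (rho κ Z Y - gW + Rr κ Z Y x) := by
      apply mul_pos hK; linarith
    have hdiff : hyp κ x Y Z - hyp κ x W Z = (hyp κ x Y Z - Z.2) - gW := by rw [hgW]; ring
    rw [hdiff]
    have hmain : c * B ≤ ((hyp κ x Y Z - Z.2) - gW) *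
        ((κ ^ 2 - 1) * (rho κ Z Y - gW + Rr κ Z Y x)) := by
      have hid : ((hyp κ x Y Z - Z.2) - gW) * ((κ ^ 2 - 1) * (rho κ Z Y - gW + Rr κ Z Y x)) =
          (2 * ⟪x - Z.1, Y.1 - Z.1⟫ - 2 * (κ ^ 2 - 1) * rho κ Z Y * gW) - B := by
        linear_combination -hq
      rw [hid]
      linarith
    have hdpos : 0 ≤ (hyp κ x Y Z - Z.2) - gW := by
      by_contra hneg
      push Not at hneg
      have := mul_neg_of_neg_of_pos hneg hpos
      have : 0 < c * B := by positivity
      linarith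
    have h4 : 0 < 4 * κ * (T1 + Δ) := by positivity
    have hmain2 : c * ((κ - 1) / (2 * κ) * ‖x - Z.1‖ ^ 2) ≤
        ((hyp κ x Y Z - Z.2) - gW) * (4 * κ * (T1 + Δ)) := by
      calc _ ≤ c * B := by gcongr
        _ ≤ _ := hmain
        _ ≤ _ := by gcongr
    rw [← div_le_iff₀ h4] at hmain2
    refine le_trans (le_of_eq ?_) hmain2
    rw [hc]; ring
  by_cases h1 : (1 + c) * B ≤ 2 * ⟪x - Z.1, Yb.1 - Z.1⟫ - 2 * (κ ^ 2 - 1) * rho κ Z Yb * gW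
  · have := fin Yb hYb s1 h1
    have := le_max_left (hyp κ x Yb Z) (hyp κ x Yh Z)
    linarith
  by_cases h2 : (1 + c) * B ≤ 2 * ⟪x - Z.1, Yh.1 - Z.1⟫ - 2 * (κ ^ 2 - 1) * rho κ Z Yh * gW
  · have := fin Yh hYh s2 h2
    have := le_max_right (hyp κ x Yb Z) (hyp κ x Yh Z)
    linarith
  exfalso
  push Not at h1 h2
  have e1 := mul_le_mul_of_nonneg_left h1.le hα
  have e2 := mul_le_mul_of_nonneg_left h2.le hβ
  have e3 : B ≤ (α + β) * ((1 + c) * B) := by linarith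
  have e4 : (α + β) * ((1 + c) * B) ≤ (1 - c) * ((1 + c) * B) := by gcongr
  nlinarith [mul_pos (mul_pos hcpos hcpos) hBpos]


/-! ### Basic facts about the refractor -/

/-- The facts of the structural setup that are used below. -/
structure Stp {n : ℕ} (κ τ₀ Δ T1 : ℝ) (Ω : Set (E n)) (Tgt : Set (E n × ℝ)) (u : E n → ℝ) :
    Prop where
  hκ : 1 < κ
  hΔ : 0 < Δ
  hT : 0 < T1
  op : IsOpen Ω
  conv : Convex ℝ Ω
  dT : ∀ Y ∈ Tgt, ∀ x ∈ Ω, ‖x - Y.1‖ ≤ Δ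
  dO : ∀ x ∈ Ω, ∀ y ∈ Ω, ‖x - y‖ ≤ Δ
  good : ∀ Z : E n × ℝ, Z.1 ∈ Ω → -(Δ / Real.sqrt (κ ^ 2 - 1)) ≤ Z.2 → Z.2 ≤ τ₀ →
    ∀ Y ∈ Tgt, Good κ Δ T1 Z Y
  ur : ∀ x ∈ Ω, 0 ≤ u x ∧ u x ≤ τ₀
  ne : ∀ x ∈ Ω, (Fu κ Ω Tgt u x).Nonempty

/-- Lipschitz constant of the gradient vectors. -/
def Lg (κ Δ : ℝ) : ℝ := 1 / (κ * Δ) + Δ * (κ + 1) / (κ * Δ) ^ 2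

lemma Stp.goodu {n : ℕ} {κ τ₀ Δ T1 : ℝ} {Ω : Set (E n)} {Tgt : Set (E n × ℝ)} {u : E n → ℝ}
    (S : Stp κ τ₀ Δ T1 Ω Tgt u) {x : E n} (hx : x ∈ Ω) {Y : E n × ℝ} (hY : Y ∈ Tgt) :
    Good κ Δ T1 (x, u x) Y := by
  have h := S.ur x hx
  have h0 : 0 ≤ Δ / Real.sqrt (κ ^ 2 - 1) := div_nonneg S.hΔ.le (Real.sqrt_nonneg _)
  exact S.good _ hx (by simp only; linarith) h.2 Y hY

lemma Stp.c_pos {n : ℕ} {κ τ₀ Δ T1 : ℝ} {Ω : Set (E n)} {Tgt : Set (E n × ℝ)} {u : E n → ℝ}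
    (S : Stp κ τ₀ Δ T1 Ω Tgt u) {x : E n} (hx : x ∈ Ω) {Y : E n × ℝ} (hY : Y ∈ Tgt) :
    0 < cfun κ (x, u x) Y := by
  have := (S.goodu hx hY).c_ge S.hκ S.hΔ
  have h2 : 0 < (κ - 1) * Δ := mul_pos (by linarith [S.hκ]) S.hΔ
  linarith

lemma Stp.fu_iff {n : ℕ} {κ τ₀ Δ T1 : ℝ} {Ω : Set (E n)} {Tgt : Set (E n × ℝ)} {u : E n → ℝ}
    (S : Stp κ τ₀ Δ T1 Ω Tgt u) {x' : E n} (hx' : x' ∈ Ω) (Y : E n × ℝ) :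
    Y ∈ Fu κ Ω Tgt u x' ↔ Y ∈ Tgt ∧ ∀ x ∈ Ω, cfun κ (x, u x) Y ≤ cfun κ (x', u x') Y := by
  unfold Fu
  constructor
  · rintro ⟨h1, h2⟩
    exact ⟨h1, fun x hx => (hypb_le_iff S.hκ Y x (u x) (S.c_pos hx' h1)).1 (h2 x hx)⟩
  · rintro ⟨h1, h2⟩
    exact ⟨h1, fun x hx => (hypb_le_iff S.hκ Y x (u x) (S.c_pos hx' h1)).2 (h2 x hx)⟩

lemma Stp.lip1 {n : ℕ} {κ τ₀ Δ T1 : ℝ} {Ω : Set (E n)} {Tgt : Set (E n × ℝ)} {u : E n → ℝ}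
    (S : Stp κ τ₀ Δ T1 Ω Tgt u) {x y : E n} (hx : x ∈ Ω) (hy : y ∈ Ω) :
    u x - u y ≤ ‖x - y‖ / Real.sqrt (κ ^ 2 - 1) := by
  obtain ⟨Y, hY⟩ := S.ne x hx
  have h1 := hY.2 y hy
  have h2 := (S.goodu hx hY.1).G_sq' S.hκ S.hΔ (S.dT Y hY.1 y hy)
  simp only at h2
  rw [norm_sub_rev] at h2
  have := (abs_le.1 h2).1
  linarith

lemma Stp.lip {n : ℕ} {κ τ₀ Δ T1 : ℝ} {Ω : Set (E n)} {Tgt : Set (E n × ℝ)} {u : E n → ℝ}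
    (S : Stp κ τ₀ Δ T1 Ω Tgt u) {x y : E n} (hx : x ∈ Ω) (hy : y ∈ Ω) :
    |u x - u y| ≤ ‖x - y‖ / Real.sqrt (κ ^ 2 - 1) := by
  rw [abs_le]
  have h1 := S.lip1 hx hy
  have h2 := S.lip1 hy hx
  rw [norm_sub_rev] at h2
  constructor <;> linarith

lemma Stp.cont {n : ℕ} {κ τ₀ Δ T1 : ℝ} {Ω : Set (E n)} {Tgt : Set (E n × ℝ)} {u : E n → ℝ}
    (S : Stp κ τ₀ Δ T1 Ω Tgt u) : ContinuousOn u Ω := by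
  have : LipschitzOnWith (Real.toNNReal (1 / Real.sqrt (κ ^ 2 - 1))) u Ω := by
    apply LipschitzOnWith.of_dist_le_mul
    intro x hx y hy
    rw [Real.dist_eq, dist_eq_norm, Real.coe_toNNReal _ (by positivity)]
    refine (S.lip hx hy).trans (le_of_eq ?_)
    ring
  exact this.continuousOn

lemma Stp.gv_lip0 {n : ℕ} {κ τ₀ Δ T1 : ℝ} {Ω : Set (E n)} {Tgt : Set (E n × ℝ)} {u : E n → ℝ}
    (S : Stp κ τ₀ Δ T1 Ω Tgt u) : 0 < Lg κ Δ := by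
  have := S.hκ
  have := S.hΔ
  have : 0 < κ := by linarith
  unfold Lg
  positivity

set_option maxHeartbeats 1000000 in
lemma Stp.crossing {n : ℕ} {κ τ₀ Δ T1 : ℝ} {Ω : Set (E n)} {Tgt : Set (E n × ℝ)} {u : E n → ℝ}
    (S : Stp κ τ₀ Δ T1 Ω Tgt u) {xb xh : E n} (hxb : xb ∈ Ω) (hxh : xh ∈ Ω)
    {Yb Yh : E n × ℝ} (hYb : Yb ∈ Fu κ Ω Tgt u xb) (hYh : Yh ∈ Fu κ Ω Tgt u xh) :
    ∃ x₀ ∈ segment ℝ xb xh, ∃ z₀ : ℝ, z₀ ≤ u x₀ ∧ -(Δ / Real.sqrt (κ ^ 2 - 1)) ≤ z₀ ∧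
      |z₀ - u xb| ≤ ‖xb - xh‖ / Real.sqrt (κ ^ 2 - 1) ∧
      (∀ x, hyp κ x Yb (x₀, z₀) = hyp κ x Yb (xb, u xb)) ∧
      (∀ x, hyp κ x Yh (x₀, z₀) = hyp κ x Yh (xh, u xh)) ∧
      u x₀ - z₀ ≤ ‖xb - xh‖ ^ 2 / (2 * κ * Δ) + Lg κ Δ * ‖xb - xh‖ * pnorm (Yb - Yh) := by
  have hκ := S.hκ
  have hΔ := S.hΔ
  have hκ0 : 0 < κ := by linarith
  have hGb := S.goodu hxb hYb.1
  have hGh := S.goodu hxh hYh.1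
  have hconn := (convex_segment (𝕜 := ℝ) xb xh).isPreconnected
  obtain ⟨x₀, hx₀, hxe⟩ := hconn.intermediate_value₂ (f := fun x => hyp κ x Yh (xh, u xh))
        (g := fun x => hyp κ x Yb (xb, u xb)) (left_mem_segment ℝ xb xh) (right_mem_segment ℝ xb xh)
        (hyp_cont κ Yh _).continuousOn (hyp_cont κ Yb _).continuousOn
        (by
          have := hyp_self hκ hΔ hGb
          simp only at this
          rw [this]; exact hYh.2 xb hxb)
        (by
          have := hyp_self hκ hΔ hGh
          simp only at this
          rw [this]; exact hYb.2 xh hxh)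
  have hx₀Ω : x₀ ∈ Ω := S.conv.segment_subset hxb hxh hx₀
  set z₀ := hyp κ x₀ Yb (xb, u xb) with hz₀
  have hrb : ∀ x, hyp κ x Yb (x₀, z₀) = hyp κ x Yb (xb, u xb) := fun x =>
    hyp_rebase hκ Yb (xb, u xb) x₀ (S.c_pos hxb hYb.1) x
  have hrh : ∀ x, hyp κ x Yh (x₀, z₀) = hyp κ x Yh (xh, u xh) := by
    intro x
    rw [← hxe]
    exact hyp_rebase hκ Yh (xh, u xh) x₀ (S.c_pos hxh hYh.1) x
  have hz1 : z₀ ≤ u x₀ := hYb.2 x₀ hx₀Ω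
  have hs : 0 < Real.sqrt (κ ^ 2 - 1) := Real.sqrt_pos.2 (by nlinarith)
  have hz2 : |z₀ - u xb| ≤ ‖x₀ - xb‖ / Real.sqrt (κ ^ 2 - 1) :=
    hGb.G_sq' hκ hΔ (S.dT Yb hYb.1 x₀ hx₀Ω)
  obtain ⟨s', s, hs'0, hs0, hss, hsx⟩ := hx₀
  have hs' : s' = 1 - s := by linarith
  subst hs'
  have e1 : xb - x₀ = -s • (xh - xb) := by rw [← hsx]; module
  have e2 : xh - x₀ = (1 - s) • (xh - xb) := by rw [← hsx]; module
  have hs1 : s ≤ 1 := by linarith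
  have n1 : ‖xb - x₀‖ = s * ‖xb - xh‖ := by
    rw [e1, norm_smul, norm_neg, Real.norm_eq_abs, abs_of_nonneg hs0, norm_sub_rev]
  have n2 : ‖xh - x₀‖ = (1 - s) * ‖xb - xh‖ := by
    rw [e2, norm_smul, Real.norm_eq_abs, abs_of_nonneg hs'0, norm_sub_rev]
  have n1' : ‖x₀ - xb‖ ≤ ‖xb - xh‖ := by
    rw [norm_sub_rev, n1]; exact mul_le_of_le_one_left (norm_nonneg _) hs1
  have hzlow : -(Δ / Real.sqrt (κ ^ 2 - 1)) ≤ z₀ := by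
    have h1 : ‖x₀ - xb‖ / Real.sqrt (κ ^ 2 - 1) ≤ Δ / Real.sqrt (κ ^ 2 - 1) := by
      gcongr
      exact S.dO _ hx₀Ω _ hxb
    have := (abs_le.1 hz2).1
    have := (S.ur xb hxb).1
    linarith
  have hz2' : |z₀ - u xb| ≤ ‖xb - xh‖ / Real.sqrt (κ ^ 2 - 1) := hz2.trans (by gcongr)
  refine ⟨x₀, ⟨1 - s, s, hs'0, hs0, hss, hsx⟩, z₀, hz1, hzlow, hz2', hrb, hrh, ?_⟩
  -- the gap
  have hZb : Good κ Δ T1 (x₀, z₀) Yb := S.good _ hx₀Ω hzlow (hz1.trans (S.ur _ hx₀Ω).2) _ hYb.1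
  have hZh : Good κ Δ T1 (x₀, z₀) Yh := S.good _ hx₀Ω hzlow (hz1.trans (S.ur _ hx₀Ω).2) _ hYh.1
  obtain ⟨Y0, hY0⟩ := S.ne x₀ hx₀Ω
  have hG0 := S.goodu hx₀Ω hY0.1
  have a1 := tangent_lower hκ hΔ hG0 xb
  have a2 := tangent_lower hκ hΔ hG0 xh
  have a3 := hY0.2 xb hxb
  have a4 := hY0.2 xh hxh
  have b1 := tangent_upper hκ hΔ hZb (S.dT Yb hYb.1 xb hxb)
  have b2 := tangent_upper hκ hΔ hZh (S.dT Yh hYh.1 xh hxh)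
  have c1 : hyp κ xb Yb (x₀, z₀) = u xb := by rw [hrb]; exact hyp_self hκ hΔ hGb
  have c2 : hyp κ xh Yh (x₀, z₀) = u xh := by rw [hrh]; exact hyp_self hκ hΔ hGh
  have hl := gv_lip hκ hΔ hZb hZh
  rw [sub_self, show pnorm (0 : E n × ℝ) = 0 by simp [pnorm], add_zero] at hl
  simp only at a1 a2 b1 b2
  rw [n1, e1, inner_smul_left] at a1
  rw [n2, e2, inner_smul_left] at a2
  rw [c1, e1, inner_smul_left] at b1
  rw [c2, e2, inner_smul_left] at b2
  simp only [conj_trivial] at a1 a2 b1 b2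
  set w := xh - xb
  set e := ‖xb - xh‖ with he
  have hw : ‖w‖ = e := norm_sub_rev _ _
  have hin : ⟪w, gv κ (x₀, z₀) Yh⟫ - ⟪w, gv κ (x₀, z₀) Yb⟫ ≤ e * (Lg κ Δ * pnorm (Yb - Yh)) := by
    rw [← inner_sub_right]
    refine (real_inner_le_norm _ _).trans ?_
    rw [hw, norm_sub_rev]
    gcongr
    exact hl
  set D := 2 * κ * Δ
  have hD : 0 < D := by positivity
  have he2 : 0 ≤ e ^ 2 / D := by positivity
  have m1 : u x₀ + -s * ⟪w, gv κ (x₀, u x₀) Y0⟫ - s ^ 2 * (e ^ 2 / D) ≤ u xb := by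
    have : (s * e) ^ 2 / D = s ^ 2 * (e ^ 2 / D) := by ring
    linarith
  have m2 : u x₀ + (1 - s) * ⟪w, gv κ (x₀, u x₀) Y0⟫ - (1 - s) ^ 2 * (e ^ 2 / D) ≤ u xh := by
    have : ((1 - s) * e) ^ 2 / D = (1 - s) ^ 2 * (e ^ 2 / D) := by ring
    linarith
  have k1 := mul_le_mul_of_nonneg_left m1 hs'0
  have k2 := mul_le_mul_of_nonneg_left m2 hs0
  have k3 := mul_le_mul_of_nonneg_left b1 hs'0
  have k4 := mul_le_mul_of_nonneg_left b2 hs0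
  have hX : 0 ≤ e * (Lg κ Δ * pnorm (Yb - Yh)) := by
    have := S.gv_lip0
    have := pnorm_nonneg (Yb - Yh)
    positivity
  have hss1 : 0 ≤ s * (1 - s) := mul_nonneg hs0 hs'0
  have hss2 : s * (1 - s) ≤ 1 := by linarith [sq_nonneg s, mul_nonneg hs0 hs'0]
  have k5 : s * (1 - s) * (⟪w, gv κ (x₀, z₀) Yh⟫ - ⟪w, gv κ (x₀, z₀) Yb⟫) ≤
      e * (Lg κ Δ * pnorm (Yb - Yh)) := by
    calc _ ≤ s * (1 - s) * (e * (Lg κ Δ * pnorm (Yb - Yh))) := by gcongr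
      _ ≤ 1 * (e * (Lg κ Δ * pnorm (Yb - Yh))) := by gcongr
      _ = _ := one_mul _
  have k6 : ((1 - s) * s ^ 2 + s * (1 - s) ^ 2) * (e ^ 2 / D) ≤ 1 * (e ^ 2 / D) := by
    have : (1 - s) * s ^ 2 + s * (1 - s) ^ 2 = s * (1 - s) := by ring
    rw [this]
    gcongr
  linarith

/-! ### The one dimensional case -/

lemma d1_alg {a1 a2 b1 b2 D1 D2 m θ : ℝ} (ha : a1 ^ 2 + a2 ^ 2 = 1) (hb : b1 ^ 2 + b2 ^ 2 = 1)
    (ha2 : 0 < a2) (hb2 : 0 < b2) (hc : b1 * a2 < a1 * b2) (hD : 0 < D1) (hm0 : 0 ≤ m)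
    (hm : |D2| ≤ m * D1)
    (ha1 : |a1| ≤ θ * a2) (hb1 : |b1| ≤ θ * b2) (hmθ : m * θ < 1) :
    0 < (a1 * D1 + a2 * D2) - (b1 * D1 + b2 * D2) := by
  have h1 : b1 < a1 := by
    by_contra hle
    push Not at hle
    rcases le_total 0 a1 with h0 | h0
    · have : b2 ≤ a2 := by
        by_contra hh
        push Not at hh
        nlinarith
      nlinarith [mul_le_mul hle this hb2.le (h0.trans hle)]
    · rcases le_total 0 b1 with h0' | h0'
      · nlinarith [mul_nonneg h0' ha2.le, mul_nonneg (neg_nonneg.2 h0) hb2.le]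
      · have : a2 ≤ b2 := by
          by_contra hh
          push Not at hh
          nlinarith
        nlinarith
  have hbr : 0 < D1 * (a2 + b2) - D2 * (a1 + b1) := by
    have e1 : |D2 * (a1 + b1)| ≤ (m * D1) * (θ * (a2 + b2)) := by
      rw [abs_mul]
      apply mul_le_mul hm _ (abs_nonneg _) (by positivity)
      refine (abs_add_le _ _).trans ?_
      linarith
    have e2 := (abs_le.1 e1).2
    have e3 : 0 < D1 * (a2 + b2) := by positivity
    nlinarith
  have key : ((a1 * D1 + a2 * D2) - (b1 * D1 + b2 * D2)) * (a2 + b2) =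
      (a1 - b1) * (D1 * (a2 + b2) - D2 * (a1 + b1)) := by
    linear_combination D2 * (ha - hb)
  have h2 : 0 < (a1 - b1) * (D1 * (a2 + b2) - D2 * (a1 + b1)) := mul_pos (by linarith) hbr
  rw [← key] at h2
  exact pos_of_mul_pos_left h2 (by positivity)

/-- Euclidean norm in the plane. -/
def N2 (a b : ℝ) : ℝ := Real.sqrt (a ^ 2 + b ^ 2)

lemma N2_deriv {a b D1 D2 t : ℝ} (h : 0 < b - t * D2) :
    HasDerivAt (fun t => N2 (a - t * D1) (b - t * D2))
      (-((a - t * D1) / N2 (a - t * D1) (b - t * D2) * D1 +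
        (b - t * D2) / N2 (a - t * D1) (b - t * D2) * D2)) t := by
  have hpos : 0 < (a - t * D1) ^ 2 + (b - t * D2) ^ 2 := by positivity
  have hN : 0 < N2 (a - t * D1) (b - t * D2) := Real.sqrt_pos.2 hpos
  have hd1 : HasDerivAt (fun t => a - t * D1) (-(1 * D1)) t :=
    ((hasDerivAt_id t).mul_const D1).const_sub a
  have hd2 : HasDerivAt (fun t => b - t * D2) (-(1 * D2)) t :=
    ((hasDerivAt_id t).mul_const D2).const_sub b
  have := ((hd1.pow 2).add (hd2.pow 2)).sqrt hpos.ne'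
  refine this.congr_deriv ?_
  simp only [Pi.add_apply, Pi.pow_apply]
  change _ / (2 * N2 (a - t * D1) (b - t * D2)) = _
  field_simp
  ring

lemma d1_mono {y1 y2 v1 v2 P1 P2 Q1 Q2 m θ : ℝ} (hPQ : P1 < Q1) (hm0 : 0 ≤ m)
    (hm : |Q2 - P2| ≤ m * (Q1 - P1)) (hmθ : m * θ < 1)
    (hy : ∀ t ∈ Set.Icc (0 : ℝ) 1, 0 < y2 - (P2 + t * (Q2 - P2)) ∧
      |y1 - (P1 + t * (Q1 - P1))| ≤ θ * (y2 - (P2 + t * (Q2 - P2))))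
    (hv : ∀ t ∈ Set.Icc (0 : ℝ) 1, 0 < v2 - (P2 + t * (Q2 - P2)) ∧
      |v1 - (P1 + t * (Q1 - P1))| ≤ θ * (v2 - (P2 + t * (Q2 - P2))))
    (hc : ∀ t ∈ Set.Icc (0 : ℝ) 1,
      (v1 - (P1 + t * (Q1 - P1))) * (y2 - (P2 + t * (Q2 - P2))) <
      (y1 - (P1 + t * (Q1 - P1))) * (v2 - (P2 + t * (Q2 - P2)))) :
    N2 (v1 - P1) (v2 - P2) - N2 (y1 - P1) (y2 - P2) <
      N2 (v1 - Q1) (v2 - Q2) - N2 (y1 - Q1) (y2 - Q2) := by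
  set D1 := Q1 - P1 with hD1
  set D2 := Q2 - P2 with hD2
  set f : ℝ → ℝ := fun t => N2 ((v1 - P1) - t * D1) ((v2 - P2) - t * D2) -
    N2 ((y1 - P1) - t * D1) ((y2 - P2) - t * D2) with hf
  have hder : ∀ t ∈ Set.Icc (0 : ℝ) 1, ∃ f', HasDerivAt f f' t ∧ 0 < f' := by
    intro t ht
    obtain ⟨py, sy⟩ := hy t ht
    obtain ⟨pv, sv⟩ := hv t ht
    have hct := hc t ht
    rw [show y2 - (P2 + t * D2) = (y2 - P2) - t * D2 by ring] at py sy hct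
    rw [show v2 - (P2 + t * D2) = (v2 - P2) - t * D2 by ring] at pv sv hct
    rw [show y1 - (P1 + t * D1) = (y1 - P1) - t * D1 by ring] at sy hct
    rw [show v1 - (P1 + t * D1) = (v1 - P1) - t * D1 by ring] at sv hct
    refine ⟨_, (N2_deriv pv).sub (N2_deriv py), ?_⟩
    set p := (y1 - P1) - t * D1
    set p' := (y2 - P2) - t * D2
    set w := (v1 - P1) - t * D1
    set w' := (v2 - P2) - t * D2
    have hNp2 : N2 p p' ^ 2 = p ^ 2 + p' ^ 2 := Real.sq_sqrt (by positivity)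
    have hNw2 : N2 w w' ^ 2 = w ^ 2 + w' ^ 2 := Real.sq_sqrt (by positivity)
    have hNp : 0 < N2 p p' := Real.sqrt_pos.2 (by positivity)
    have hNw : 0 < N2 w w' := Real.sqrt_pos.2 (by positivity)
    have := d1_alg (a1 := p / N2 p p') (a2 := p' / N2 p p') (b1 := w / N2 w w')
      (b2 := w' / N2 w w') (D1 := D1) (D2 := D2) (m := m) (θ := θ)
      (by rw [div_pow, div_pow, ← add_div, ← hNp2]; field_simp)
      (by rw [div_pow, div_pow, ← add_div, ← hNw2]; field_simp)
      (by positivity) (by positivity)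
      (by
        rw [div_mul_div_comm, div_mul_div_comm, mul_comm (N2 w w')]
        gcongr)
      (by linarith) hm0 hm
      (by rw [abs_div, abs_of_pos hNp, ← mul_div_assoc]; gcongr)
      (by rw [abs_div, abs_of_pos hNw, ← mul_div_assoc]; gcongr) hmθ
    linarith
  have hmono : StrictMonoOn f (Set.Icc 0 1) := by
    apply strictMonoOn_of_deriv_pos (convex_Icc 0 1)
    · intro t ht
      obtain ⟨f', h, _⟩ := hder t ht
      exact h.continuousAt.continuousWithinAt
    · intro t ht
      rw [interior_Icc] at ht
      obtain ⟨f', h, hp⟩ := hder t ⟨ht.1.le, ht.2.le⟩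
      rw [h.deriv]; exact hp
  have := hmono (Set.left_mem_Icc.2 zero_le_one) (Set.right_mem_Icc.2 zero_le_one) zero_lt_one
  simpa [hf, hD1, hD2] using this

/-- Cross product in dimension one. -/
def Psi (Y V X : E 1 × ℝ) : ℝ :=
  (Y.1 0 - X.1 0) * (V.2 - X.2) - (V.1 0 - X.1 0) * (Y.2 - X.2)

lemma E1_norm (x : E 1) : ‖x‖ = |x 0| := by
  rw [EuclideanSpace.norm_eq]
  simp [Real.sqrt_sq_eq_abs]

lemma E1_pnorm (X V : E 1 × ℝ) : pnorm (X - V) = N2 (V.1 0 - X.1 0) (V.2 - X.2) := by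
  rw [pnorm_sub_comm]
  unfold pnorm N2
  rw [E1_norm]
  simp

lemma Stp.d1_pair {κ τ₀ Δ T1 : ℝ} {Ω : Set (E 1)} {Tgt : Set (E 1 × ℝ)} {u : E 1 → ℝ}
    (S : Stp κ τ₀ Δ T1 Ω Tgt u) {Y V : E 1 × ℝ} (hY : Y ∈ Tgt) (hV : V ∈ Tgt)
    (hpsi : ∀ X : E 1 × ℝ, X.1 ∈ Ω → X.2 ∈ Set.Icc 0 τ₀ → 0 < Psi Y V X)
    {p q : E 1} (hp : p ∈ Ω) (hq : q ∈ Ω) (hpq : p 0 < q 0) :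
    pnorm ((p, u p) - V) - pnorm ((p, u p) - Y) < pnorm ((q, u q) - V) - pnorm ((q, u q) - Y) := by
  have hκ := S.hκ
  have hΔ := S.hΔ
  have hK : 0 < κ ^ 2 - 1 := by nlinarith
  have hs : 0 < Real.sqrt (κ ^ 2 - 1) := Real.sqrt_pos.2 hK
  have hκ1 : 0 < κ - 1 := by linarith
  have hmem : ∀ t ∈ Set.Icc (0 : ℝ) 1, p + t • (q - p) ∈ Ω ∧ u p + t * (u q - u p) ∈ Set.Icc 0 τ₀ := by
    intro t ht
    refine ⟨S.conv.add_smul_sub_mem hp hq ht, ?_⟩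
    exact (convex_Icc (0 : ℝ) τ₀).add_smul_sub_mem (S.ur p hp) (S.ur q hq) ht
  have hgood : ∀ Y ∈ Tgt, ∀ t ∈ Set.Icc (0 : ℝ) 1, 0 < Y.2 - (u p + t * (u q - u p)) ∧
      |Y.1 0 - (p 0 + t * (q 0 - p 0))| ≤ (κ - 1) / κ * (Y.2 - (u p + t * (u q - u p))) := by
    intro Y hY t ht
    obtain ⟨m1, m2⟩ := hmem t ht
    have h0 : 0 ≤ Δ / Real.sqrt (κ ^ 2 - 1) := by positivity
    have hg := S.good (p + t • (q - p), u p + t * (u q - u p)) m1 (by simp only; linarith [m2.1])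
      m2.2 Y hY
    obtain ⟨g1, g2, _⟩ := hg
    simp only at g1 g2
    rw [E1_norm] at g1
    have e : (Y.1 - (p + t • (q - p))) 0 = Y.1 0 - (p 0 + t * (q 0 - p 0)) := by simp
    rw [e] at g1
    have hpos : 0 < κ * Δ / (κ - 1) := by positivity
    refine ⟨by linarith, g1.trans ?_⟩
    calc Δ = (κ - 1) / κ * (κ * Δ / (κ - 1)) := by field_simp
      _ ≤ _ := by gcongr
  rw [E1_pnorm, E1_pnorm, E1_pnorm, E1_pnorm]
  apply d1_mono (m := 1 / Real.sqrt (κ ^ 2 - 1)) (θ := (κ - 1) / κ) hpq (by positivity)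
  · have := S.lip hq hp
    rw [E1_norm] at this
    simp only [PiLp.sub_apply] at this
    rw [abs_of_pos (show 0 < q 0 - p 0 by linarith)] at this
    simp only
    linarith [this, show (q 0 - p 0) / Real.sqrt (κ ^ 2 - 1) =
      1 / Real.sqrt (κ ^ 2 - 1) * (q 0 - p 0) by ring]
  · rw [div_mul_div_comm, one_mul, div_lt_one (by positivity)]
    have hs2 := Real.sq_sqrt hK.le
    have : κ - 1 < Real.sqrt (κ ^ 2 - 1) := by
      apply Real.lt_sqrt_of_sq_lt
      nlinarith
    nlinarith
  · exact hgood Y hY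
  · exact hgood V hV
  · intro t ht
    obtain ⟨m1, m2⟩ := hmem t ht
    have := hpsi (p + t • (q - p), u p + t * (u q - u p)) m1 m2
    unfold Psi at this
    simp only [PiLp.add_apply, PiLp.smul_apply, PiLp.sub_apply, smul_eq_mul] at this
    linarith

lemma Stp.d1_psi {κ τ₀ Δ T1 : ℝ} {Ω : Set (E 1)} {Tgt : Set (E 1 × ℝ)} {u : E 1 → ℝ}
    (S : Stp κ τ₀ Δ T1 Ω Tgt u)
    (sfun : (E 1 × ℝ) → (E 1 × ℝ) → ℝ) (hspos : ∀ X d, 0 < sfun X d)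
    (hparam : ∀ X : E 1 × ℝ, X.1 ∈ Ω → X.2 ∈ Set.Icc 0 τ₀ → ∀ Y ∈ Tgt,
      ∃ d : E 1 × ℝ, pnorm d = 1 ∧ Y = X + sfun X d • d)
    {Y V : E 1 × ℝ} (hY : Y ∈ Tgt) (hV : V ∈ Tgt) (hne : Y ≠ V)
    {X : E 1 × ℝ} (hX1 : X.1 ∈ Ω) (hX2 : X.2 ∈ Set.Icc 0 τ₀) : Psi Y V X ≠ 0 := by
  intro h0
  have hκ := S.hκ
  have hΔ := S.hΔ
  have hκ1 : 0 < κ - 1 := by linarith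
  have hpos : 0 < κ * Δ / (κ - 1) := by positivity
  have hn0 : 0 ≤ Δ / Real.sqrt (κ ^ 2 - 1) := by positivity
  have gY := (S.good X hX1 (by linarith [hX2.1]) hX2.2 Y hY).2.1
  have gV := (S.good X hX1 (by linarith [hX2.1]) hX2.2 V hV).2.1
  obtain ⟨d, hd, hYd⟩ := hparam X hX1 hX2 Y hY
  obtain ⟨d', hd', hVd⟩ := hparam X hX1 hX2 V hV
  have hs := hspos X d
  have hs' := hspos X d'
  set s := sfun X d with hsd
  set s' := sfun X d' with hsd'
  have y1 : Y.1 0 - X.1 0 = s * d.1 0 := by rw [hYd]; simp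
  have y2 : Y.2 - X.2 = s * d.2 := by rw [hYd]; simp
  have v1 : V.1 0 - X.1 0 = s' * d'.1 0 := by rw [hVd]; simp
  have v2 : V.2 - X.2 = s' * d'.2 := by rw [hVd]; simp
  unfold Psi at h0
  rw [y1, y2, v1, v2] at h0
  have hd2 : 0 < d.2 := pos_of_mul_pos_right (a := s) (by linarith) hs.le
  have hd2' : 0 < d'.2 := pos_of_mul_pos_right (a := s') (by linarith) hs'.le
  have n1 : (d.1 0) ^ 2 + d.2 ^ 2 = 1 := by
    have := pnorm_sq d
    rw [hd, E1_norm, sq_abs] at this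
    linarith
  have n2 : (d'.1 0) ^ 2 + d'.2 ^ 2 = 1 := by
    have := pnorm_sq d'
    rw [hd', E1_norm, sq_abs] at this
    linarith
  have hx : d.1 0 * d'.2 = d'.1 0 * d.2 := by
    have : (s * s') * (d.1 0 * d'.2 - d'.1 0 * d.2) = 0 := by linear_combination h0
    rcases mul_eq_zero.1 this with h | h
    · exact absurd h (by positivity)
    · linarith
  have h2 : d.2 = d'.2 := by
    have : d.2 ^ 2 = d'.2 ^ 2 := by
      linear_combination d'.2 ^ 2 * n1 - d.2 ^ 2 * n2 - (d.1 0 * d'.2 + d'.1 0 * d.2) * hx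
    exact (pow_left_inj₀ hd2.le hd2'.le (by norm_num)).1 this
  have h1 : d.1 0 = d'.1 0 := by
    rw [h2] at hx
    exact mul_right_cancel₀ hd2'.ne' hx
  have hdd : d = d' := by
    apply Prod.ext
    · ext i
      fin_cases i
      exact h1
    · exact h2
  apply hne
  rw [hYd, hVd, hsd, hsd', hdd]

lemma Stp.dim1 {κ τ₀ Δ T1 : ℝ} {Ω : Set (E 1)} {Tgt : Set (E 1 × ℝ)} {u : E 1 → ℝ}
    (S : Stp κ τ₀ Δ T1 Ω Tgt u)
    (sfun : (E 1 × ℝ) → (E 1 × ℝ) → ℝ) (hspos : ∀ X d, 0 < sfun X d)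
    (hparam : ∀ X : E 1 × ℝ, X.1 ∈ Ω → X.2 ∈ Set.Icc 0 τ₀ → ∀ Y ∈ Tgt,
      ∃ d : E 1 × ℝ, pnorm d = 1 ∧ Y = X + sfun X d • d)
    {Y : E 1 × ℝ} (hY : Y ∈ Tgt) {x y z : E 1} (hx : x ∈ Ω) (hz : z ∈ Ω)
    (hy : y ∈ segment ℝ x z) (h1 : cfun κ (y, u y) Y < cfun κ (x, u x) Y)
    (h2 : cfun κ (y, u y) Y < cfun κ (z, u z) Y) : False := by
  have hyΩ : y ∈ Ω := S.conv.segment_subset hx hz hy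
  obtain ⟨V, hV⟩ := S.ne y hyΩ
  have hVm := ((S.fu_iff hyΩ V).1 hV).2
  have k1 := hVm x hx
  have k2 := hVm z hz
  have hne : Y ≠ V := by
    rintro rfl
    linarith
  have q1 : pnorm ((y, u y) - V) - pnorm ((y, u y) - Y) <
      pnorm ((x, u x) - V) - pnorm ((x, u x) - Y) := by
    unfold cfun at *; simp only at *; linarith
  have q2 : pnorm ((y, u y) - V) - pnorm ((y, u y) - Y) <
      pnorm ((z, u z) - V) - pnorm ((z, u z) - Y) := by
    unfold cfun at *; simp only at *; linarith
  -- order of the three points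
  have hxy : x 0 ≠ y 0 := by
    intro h
    have : x = y := by ext i; fin_cases i; exact h
    subst this; linarith
  have hzy : z 0 ≠ y 0 := by
    intro h
    have : z = y := by ext i; fin_cases i; exact h
    subst this; linarith
  have hord : (x 0 < y 0 ∧ y 0 < z 0) ∨ (z 0 < y 0 ∧ y 0 < x 0) := by
    obtain ⟨a, b, ha, hb, hab, e⟩ := hy
    have e0 : y 0 = a * x 0 + b * z 0 := by rw [← e]; simp
    have ha' : a = 1 - b := by linarith
    subst ha'
    rcases lt_or_gt_of_ne hxy with h | h
    · left
      refine ⟨h, ?_⟩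
      by_contra hc
      push Not at hc
      have h3 := lt_of_le_of_ne hc hzy
      have h4 := max_lt h h3
      have h5 := mul_le_mul_of_nonneg_left (le_max_left (x 0) (z 0)) ha
      have h6 := mul_le_mul_of_nonneg_left (le_max_right (x 0) (z 0)) hb
      linarith
    · right
      refine ⟨?_, h⟩
      by_contra hc
      push Not at hc
      have h3 := lt_of_le_of_ne hc hzy.symm
      have h4 := lt_min h h3
      have h5 := mul_le_mul_of_nonneg_left (min_le_left (x 0) (z 0)) ha
      have h6 := mul_le_mul_of_nonneg_left (min_le_right (x 0) (z 0)) hb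
      linarith
  -- sign of the cross product
  set C : Set (E 1 × ℝ) := Ω ×ˢ Set.Icc 0 τ₀ with hC
  have hCc : IsPreconnected C := (S.conv.prod (convex_Icc 0 τ₀)).isPreconnected
  have hcont : Continuous (Psi Y V) := by unfold Psi; fun_prop
  have hyC : ((y, u y) : E 1 × ℝ) ∈ C := ⟨hyΩ, S.ur y hyΩ⟩
  have hn0 : ∀ X ∈ C, Psi Y V X ≠ 0 := fun X hX =>
    S.d1_psi sfun hspos hparam hY hV.1 hne hX.1 hX.2
  rcases lt_or_gt_of_ne (hn0 _ hyC) with hs | hs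
  · have hall : ∀ X : E 1 × ℝ, X.1 ∈ Ω → X.2 ∈ Set.Icc 0 τ₀ → 0 < Psi V Y X := by
      intro X hX1 hX2
      have hX : X ∈ C := ⟨hX1, hX2⟩
      have : Psi Y V X < 0 := by
        by_contra hc
        push Not at hc
        obtain ⟨X', hX', e⟩ := hCc.intermediate_value₂ hyC hX hcont.continuousOn
          continuousOn_const hs.le hc
        exact hn0 X' hX' e
      unfold Psi at *
      linarith
    rcases hord with ⟨o1, o2⟩ | ⟨o1, o2⟩
    · have := S.d1_pair hV.1 hY hall hyΩ hz o2
      linarith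
    · have := S.d1_pair hV.1 hY hall hyΩ hx o2
      linarith
  · have hall : ∀ X : E 1 × ℝ, X.1 ∈ Ω → X.2 ∈ Set.Icc 0 τ₀ → 0 < Psi Y V X := by
      intro X hX1 hX2
      have hX : X ∈ C := ⟨hX1, hX2⟩
      by_contra hc
      push Not at hc
      obtain ⟨X', hX', e⟩ := hCc.intermediate_value₂ hX hyC hcont.continuousOn
        continuousOn_const hc hs.le
      exact hn0 X' hX' e
    rcases hord with ⟨o1, o2⟩ | ⟨o1, o2⟩
    · have := S.d1_pair hY hV.1 hall hx hyΩ o1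
      linarith
    · have := S.d1_pair hY hV.1 hall hz hyΩ o1
      linarith

/-! ### Supporting points near the crossing point -/

lemma Stp.interior {n : ℕ} {κ τ₀ Δ T1 : ℝ} {Ω : Set (E n)} {Tgt : Set (E n × ℝ)} {u : E n → ℝ}
    (S : Stp κ τ₀ Δ T1 Ω Tgt u) {Y : E n × ℝ} (hY : Y ∈ Tgt) {x₀ : E n} {η : ℝ}
    (hη : 0 < η) (hball : Metric.closedBall x₀ η ⊆ Ω)
    (hsph : ∀ x ∈ Ω, ‖x - x₀‖ = η → hyp κ x Y (x₀, u x₀) < u x)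
    (hfar : (∀ x ∈ Ω, η ≤ ‖x - x₀‖ → hyp κ x Y (x₀, u x₀) < u x) ∨
      (∀ x y z : E n, x ∈ Ω → z ∈ Ω → y ∈ segment ℝ x z →
        cfun κ (y, u y) Y < cfun κ (x, u x) Y → cfun κ (y, u y) Y < cfun κ (z, u z) Y → False)) :
    ∃ x' ∈ Metric.ball x₀ η, Y ∈ Fu κ Ω Tgt u x' := by
  have hx₀B : x₀ ∈ Metric.closedBall x₀ η := Metric.mem_closedBall_self hη.le
  have hx₀ : x₀ ∈ Ω := hball hx₀B
  have hlt : ∀ x, hyp κ x Y (x₀, u x₀) < u x → cfun κ (x, u x) Y < cfun κ (x₀, u x₀) Y :=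
    fun x h => (hypb_lt_iff S.hκ Y x (u x) (S.c_pos hx₀ hY)).1 h
  have hcont : ContinuousOn (fun x => cfun κ (x, u x) Y) (Metric.closedBall x₀ η) := by
    have hc := S.cont.mono hball
    unfold cfun pnorm
    simp only [Prod.fst_sub, Prod.snd_sub]
    fun_prop
  obtain ⟨x', hx'B, hmax⟩ := (isCompact_closedBall x₀ η).exists_isMaxOn ⟨x₀, hx₀B⟩ hcont
  have hmax' : ∀ x ∈ Metric.closedBall x₀ η, cfun κ (x, u x) Y ≤ cfun κ (x', u x') Y := hmax
  have hx'Ω := hball hx'B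
  have h0 := hmax' x₀ hx₀B
  have hx'b : ‖x' - x₀‖ < η := by
    rw [mem_closedBall_iff_norm] at hx'B
    refine lt_of_le_of_ne hx'B ?_
    intro he
    have := hlt x' (hsph x' hx'Ω he)
    linarith
  refine ⟨x', by rwa [mem_ball_iff_norm], ?_⟩
  rw [S.fu_iff hx'Ω]
  refine ⟨hY, ?_⟩
  intro x hx
  rcases le_or_gt ‖x - x₀‖ η with hin | hout
  · exact hmax' x (by rwa [mem_closedBall_iff_norm])
  rcases hfar with hfar | hfar
  · have := hlt x (hfar x hx hout.le)
    linarith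
  · by_contra hc
    push Not at hc
    have hconn := (convex_segment (𝕜 := ℝ) x' x).isPreconnected
    obtain ⟨y, hy, hye⟩ := hconn.intermediate_value₂ (f := fun y => ‖y - x₀‖) (g := fun _ => η)
      (left_mem_segment ℝ x' x) (right_mem_segment ℝ x' x) (by fun_prop) (by fun_prop)
      hx'b.le hout.le
    have hyΩ := S.conv.segment_subset hx'Ω hx hy
    have := hlt y (hsph y hyΩ hye)
    exact hfar x' y x hx'Ω hx hy (by linarith) (by linarith)

/-- The constant in `G_diff`. -/
def Cg (κ Δ : ℝ) : ℝ := (κ + 1) / Δ * (1 / (κ ^ 2 - 1) + (κ + 1) / (κ ^ 2 - 1) / √(κ ^ 2 - 1))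

/-- The constant in `glob_gap`. -/
def cG (κ Δ T1 : ℝ) : ℝ := (κ - 1) * Δ * ((κ - 1) / (2 * κ)) / (4 * κ * (T1 + Δ))

/-- Strict inequality away from the crossing point. -/
lemma Stp.far {n : ℕ} {κ τ₀ Δ T1 : ℝ} {Ω : Set (E n)} {Tgt : Set (E n × ℝ)} {u : E n → ℝ}
    (S : Stp κ τ₀ Δ T1 Ω Tgt u) {Y W Yb Yh : E n × ℝ} (hY : Y ∈ Tgt) (hW : W ∈ Tgt)
    {x₀ : E n} {z₀ η μ c e d Ce : ℝ} (hx₀ : x₀ ∈ Ω) (hz1 : z₀ ≤ u x₀)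
    (hz2 : -(Δ / Real.sqrt (κ ^ 2 - 1)) ≤ z₀)
    (hgap : u x₀ - z₀ ≤ Ce * e * d)
    (hd : 0 < d) (hη : 0 < η) (hc : 0 < c)
    (hYW : pnorm (Y - W) ≤ μ) (hμ : Cg κ Δ * μ ≤ c / 3 * d ^ 2 * η)
    (hM : (1 + Cg κ Δ * Δ) * Ce * e ≤ c / 3 * (η ^ 2 * d))
    {x : E n} (hx : x ∈ Ω) (hxη : η ≤ ‖x - x₀‖)
    (hub : hyp κ x Yb (x₀, z₀) ≤ u x) (huh : hyp κ x Yh (x₀, z₀) ≤ u x)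
    (hmx : hyp κ x W (x₀, z₀) ≤ max (hyp κ x Yb (x₀, z₀)) (hyp κ x Yh (x₀, z₀)) -
      c * d ^ 2 * ‖x - x₀‖ ^ 2) :
    hyp κ x Y (x₀, u x₀) < u x := by
  have hκ := S.hκ
  have hΔ := S.hΔ
  have hK : 0 < κ ^ 2 - 1 := by nlinarith
  have hCg : 0 ≤ Cg κ Δ := by
    unfold Cg
    have : 0 < κ + 1 := by linarith
    positivity
  have gY := S.goodu hx₀ hY
  have gW : Good κ Δ T1 (x₀, z₀) W := S.good _ hx₀ hz2 (hz1.trans (S.ur _ hx₀).2) _ hW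
  have hG := (abs_le.1 (G_diff hκ hΔ gY gW rfl (S.dT Y hY x hx) (S.dT W hW x hx))).2
  have hpz : pnorm ((x₀, u x₀) - (x₀, z₀) : E n × ℝ) = u x₀ - z₀ := by
    unfold pnorm
    simp only [Prod.mk_sub_mk, sub_self, norm_zero]
    rw [zero_pow two_ne_zero, zero_add, Real.sqrt_sq (by linarith)]
  rw [hpz] at hG
  change _ ≤ Cg κ Δ * ‖x - x₀‖ * _ at hG
  simp only at hG
  set ρ := ‖x - x₀‖ with hρ
  have hρΔ : ρ ≤ Δ := S.dO x hx x₀ hx₀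
  have hρ0 : 0 < ρ := lt_of_lt_of_le hη hxη
  set ε := u x₀ - z₀ with hε
  have hε0 : 0 ≤ ε := by linarith
  have h1 : Cg κ Δ * ρ * pnorm (Y - W) ≤ c / 3 * d ^ 2 * ρ ^ 2 := by
    calc Cg κ Δ * ρ * pnorm (Y - W) ≤ Cg κ Δ * ρ * μ := by gcongr
      _ = (Cg κ Δ * μ) * ρ := by ring
      _ ≤ (c / 3 * d ^ 2 * η) * ρ := by gcongr
      _ ≤ (c / 3 * d ^ 2 * ρ) * ρ := by gcongr
      _ = _ := by ring
  have h2 : ε + Cg κ Δ * ρ * ε ≤ c / 3 * d ^ 2 * ρ ^ 2 := by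
    calc ε + Cg κ Δ * ρ * ε = (1 + Cg κ Δ * ρ) * ε := by ring
      _ ≤ (1 + Cg κ Δ * Δ) * (Ce * e * d) := by gcongr
      _ = ((1 + Cg κ Δ * Δ) * Ce * e) * d := by ring
      _ ≤ (c / 3 * (η ^ 2 * d)) * d := by gcongr
      _ ≤ (c / 3 * (ρ ^ 2 * d)) * d := by gcongr
      _ = _ := by ring
  have h3 := max_le hub huh
  have h4 : 0 < c * d ^ 2 * ρ ^ 2 := by positivity
  have h5 : Cg κ Δ * ρ * (pnorm (Y - W) + ε) = Cg κ Δ * ρ * pnorm (Y - W) + Cg κ Δ * ρ * ε := by ring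
  linarith

set_option maxHeartbeats 1000000 in
lemma Stp.key {n : ℕ} {κ τ₀ Δ T1 : ℝ} {Ω : Set (E n)} {Tgt : Set (E n × ℝ)} {u : E n → ℝ}
    (S : Stp κ τ₀ Δ T1 Ω Tgt u) (hn : 1 ≤ n)
    (sfun : (E n × ℝ) → (E n × ℝ) → ℝ)
    (hspos : ∀ X d, 0 < sfun X d)
    (hparam : ∀ X : E n × ℝ, X.1 ∈ Ω → X.2 ∈ Set.Icc 0 τ₀ → ∀ Y ∈ Tgt,
      ∃ d : E n × ℝ, pnorm d = 1 ∧ Y = X + sfun X d • d)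
    (xstar : E n) (hxstar : xstar ∈ Ω)
    (hreg : ∃ U ∈ nhds ((xstar, u xstar) : E n × ℝ), ∃ c₁ : ℝ, 0 < c₁ ∧ ∃ c₂ : ℝ, 0 < c₂ ∧
      ∀ Yb ∈ Tgt, ∀ Yh ∈ Tgt, ∀ Z ∈ U, ∀ lam ∈ Set.Icc (1/4 : ℝ) (3/4),
        ∀ x ∈ Ω, ‖x - Z.1‖ ≤ c₂ →
          hyp κ x (YZlam κ sfun Z Yb Yh lam) Z
            ≤ max (hyp κ x Yb Z) (hyp κ x Yh Z)
              - c₁ * (pnorm (Yb - Yh)) ^ 2 * ‖x - Z.1‖ ^ 2)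
    (σ : MeasureTheory.Measure (E n × ℝ))
    (q : ℝ) (Ctil C₀ : ℝ) (hC₀ : 0 < C₀)
    (hgrowth1 : ∃ U ∈ nhds ((xstar, u xstar) : E n × ℝ), ∃ μ₀ : ℝ, 0 < μ₀ ∧
      ∀ Yb ∈ Tgt, ∀ Yh ∈ Tgt, ∀ Z ∈ U, ∀ μ : ℝ, 0 < μ → μ < μ₀ →
        ENNReal.ofReal (Ctil * μ ^ (n - 1) * pnorm (Yb - Yh))
          ≤ σ ({Y : E n × ℝ | ∃ lam ∈ Set.Icc (1/4 : ℝ) (3/4),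
                YZlam κ sfun Z Yb Yh lam ∈ Tgt ∧
                pnorm (Y - YZlam κ sfun Z Yb Yh lam) < μ} ∩ Tgt))
    (hgrowth2 : ∀ (z : E n) (r : ℝ), 0 < r → Metric.closedBall z r ⊆ Ω →
      σ (⋃ x ∈ Metric.ball z r, Fu κ Ω Tgt u x) ≤ ENNReal.ofReal (C₀ * r ^ ((n : ℝ) / q))) :
    ∃ δ : ℝ, 0 < δ ∧ ∃ M : ℝ, 0 < M ∧ ∃ C₂ : ℝ, 0 < C₂ ∧ ∃ cμ : ℝ, 0 < cμ ∧
      Metric.ball xstar δ ⊆ Ω ∧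
      ∀ xb ∈ Metric.ball xstar (δ / 2), ∀ xh ∈ Metric.ball xstar (δ / 2),
        ∀ Yb ∈ Fu κ Ω Tgt u xb, ∀ Yh ∈ Fu κ Ω Tgt u xh, ‖xb - xh‖ ≤ pnorm (Yb - Yh) →
        0 < pnorm (Yb - Yh) → ∀ η : ℝ, 0 < η → η ≤ δ / 2 → η ≤ C₂ / 2 →
        M ^ 2 * ‖xb - xh‖ ≤ η ^ 2 * pnorm (Yb - Yh) →
        Ctil * (cμ * pnorm (Yb - Yh) ^ 2 * η) ^ (n - 1) * pnorm (Yb - Yh) ≤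
          C₀ * η ^ ((n : ℝ) / q) := by
  have hκ := S.hκ
  have hΔ := S.hΔ
  have hT := S.hT
  have hκ0 : 0 < κ := by linarith
  have hκ1 : 0 < κ - 1 := by linarith
  have hK : 0 < κ ^ 2 - 1 := by nlinarith
  set sq := Real.sqrt (κ ^ 2 - 1) with hsq
  have hs : 0 < sq := Real.sqrt_pos.2 hK
  obtain ⟨U1, hU1, c₁, hc₁, c₂, hc₂, hreg⟩ := hreg
  obtain ⟨U2, hU2, μ₀, hμ₀, hgr⟩ := hgrowth1
  obtain ⟨r, hr, hrU⟩ := Metric.mem_nhds_iff.1 (Filter.inter_mem hU1 hU2)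
  obtain ⟨δ₁, hδ₁, hδΩ⟩ := Metric.isOpen_iff.1 S.op xstar hxstar
  set δ := min δ₁ (min (r / 2) (r * sq / 2)) with hδdef
  have hδ : 0 < δ := lt_min hδ₁ (lt_min (by positivity) (by positivity))
  have hδle1 : δ ≤ δ₁ := min_le_left _ _
  have hδle2 : δ ≤ r / 2 := (min_le_right _ _).trans (min_le_left _ _)
  have hδle3 : δ ≤ r * sq / 2 := (min_le_right _ _).trans (min_le_right _ _)
  have hδΩ' : Metric.ball xstar δ ⊆ Ω := (Metric.ball_subset_ball hδle1).trans hδΩ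
  have hCg : 0 < Cg κ Δ := by
    unfold Cg
    have : 0 < κ + 1 := by linarith
    positivity
  have hcG : 0 < cG κ Δ T1 := by unfold cG; positivity
  set c := min (cG κ Δ T1) 1 * c₁ with hcdef
  have hc : 0 < c := mul_pos (lt_min hcG one_pos) hc₁
  have hcle1 : c ≤ cG κ Δ T1 * c₁ := by rw [hcdef]; gcongr; exact min_le_left _ _
  have hcle2 : c ≤ c₁ := by
    calc c ≤ 1 * c₁ := by rw [hcdef]; gcongr; exact min_le_right _ _
      _ = c₁ := one_mul _
  set Ce := 1 / (2 * κ * Δ) + Lg κ Δ with hCe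
  have hLg := S.gv_lip0
  have hCe0 : 0 < Ce := by positivity
  set Dm := 2 * Δ + T1 with hDm
  have hDm0 : 0 < Dm := by positivity
  set M := Real.sqrt (3 * ((1 + Cg κ Δ * Δ) * Ce) / c) with hM
  have hM0 : 0 < M := Real.sqrt_pos.2 (by positivity)
  have hM2 : M ^ 2 = 3 * ((1 + Cg κ Δ * Δ) * Ce) / c := Real.sq_sqrt (by positivity)
  set cμ := min (c / (3 * Cg κ Δ)) (μ₀ / (2 * Dm ^ 2 * δ)) with hcμ
  have hcμ0 : 0 < cμ := lt_min (by positivity) (by positivity)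
  refine ⟨δ, hδ, M, hM0, c₂, hc₂, cμ, hcμ0, hδΩ', ?_⟩
  intro xb hxb xh hxh Yb hYb Yh hYh hed hd η hη hηδ hηc hMη
  have hxbΩ : xb ∈ Ω := hδΩ' (Metric.ball_subset_ball (by linarith) hxb)
  have hxhΩ : xh ∈ Ω := hδΩ' (Metric.ball_subset_ball (by linarith) hxh)
  obtain ⟨x₀, hx₀s, z₀, hz1, hz2, hz3, hrb, hrh, hgap⟩ := S.crossing hxbΩ hxhΩ hYb hYh
  have hx₀b : x₀ ∈ Metric.ball xstar (δ / 2) := (convex_ball xstar (δ / 2)).segment_subset hxb hxh hx₀s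
  have hx₀Ω : x₀ ∈ Ω := S.conv.segment_subset hxbΩ hxhΩ hx₀s
  set d := pnorm (Yb - Yh) with hddef
  set e := ‖xb - xh‖ with hedef
  have he0 : 0 ≤ e := norm_nonneg _
  have hgap' : u x₀ - z₀ ≤ Ce * e * d := by
    have h1 : e ^ 2 / (2 * κ * Δ) ≤ 1 / (2 * κ * Δ) * e * d := by
      calc e ^ 2 / (2 * κ * Δ) = 1 / (2 * κ * Δ) * e * e := by ring
        _ ≤ _ := by gcongr
    have : Ce * e * d = 1 / (2 * κ * Δ) * e * d + Lg κ Δ * e * d := by rw [hCe]; ring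
    linarith
  -- Z is close to X*
  have hZ : ((x₀, z₀) : E n × ℝ) ∈ U1 ∩ U2 := by
    apply hrU
    rw [Metric.mem_ball, Prod.dist_eq, max_lt_iff]
    simp only
    constructor
    · rw [Metric.mem_ball] at hx₀b
      linarith
    · rw [Real.dist_eq]
      have hxbs := S.lip hxbΩ hxstar
      rw [mem_ball_iff_norm] at hxb hxh
      have heδ : e < δ := by
        have : xb - xh = (xb - xstar) - (xh - xstar) := by abel
        rw [hedef, this]
        refine (norm_sub_le _ _).trans_lt ?_
        linarith
      have h1 : e / sq ≤ δ / sq := by gcongr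
      have h2 : ‖xb - xstar‖ / sq ≤ (δ / 2) / sq := by gcongr
      have h3 : δ / sq ≤ r / 2 := by
        rw [div_le_iff₀ hs]; linarith
      have h4 : z₀ - u xstar = (z₀ - u xb) + (u xb - u xstar) := by ring
      rw [h4]
      refine (abs_add_le _ _).trans_lt ?_
      have h5 : (δ / 2) / sq = (δ / sq) / 2 := by ring
      linarith
  -- bound on d
  have gb := S.goodu hxbΩ hYb.1
  have gh := S.goodu hxbΩ hYh.1
  have hdD : d ≤ Dm := by
    refine (pnorm_le _).trans ?_
    have h1 : ‖(Yb - Yh).1‖ ≤ 2 * Δ := by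
      have : (Yb - Yh).1 = (Yb.1 - xb) - (Yh.1 - xb) := by
        rw [Prod.fst_sub]; abel
      rw [this]
      refine (norm_sub_le _ _).trans ?_
      have := gb.1
      have := gh.1
      simp only at *
      linarith
    have h2 : |(Yb - Yh).2| ≤ T1 := by
      obtain ⟨_, a1, a2⟩ := gb
      obtain ⟨_, b1, b2⟩ := gh
      have : 0 < κ * Δ / (κ - 1) := by positivity
      simp only at a1 a2 b1 b2
      rw [Prod.snd_sub, abs_le]
      constructor <;> linarith
    linarith
  set μ := cμ * d ^ 2 * η with hμ
  have hμ0 : 0 < μ := by positivity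
  have hμlt : μ < μ₀ := by
    have : μ ≤ μ₀ / (2 * Dm ^ 2 * δ) * Dm ^ 2 * (δ / 2) := by
      rw [hμ]
      gcongr
      exact min_le_right _ _
    have h2 : μ₀ / (2 * Dm ^ 2 * δ) * Dm ^ 2 * (δ / 2) = μ₀ / 4 := by field_simp; ring
    linarith
  have hμ' : Cg κ Δ * μ ≤ c / 3 * d ^ 2 * η := by
    have h1 : cμ ≤ c / (3 * Cg κ Δ) := min_le_left _ _
    calc Cg κ Δ * μ ≤ Cg κ Δ * (c / (3 * Cg κ Δ) * d ^ 2 * η) := by rw [hμ]; gcongr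
      _ = _ := by field_simp
  have hM' : (1 + Cg κ Δ * Δ) * Ce * e ≤ c / 3 * (η ^ 2 * d) := by
    calc (1 + Cg κ Δ * Δ) * Ce * e = c / 3 * (M ^ 2 * e) := by rw [hM2]; field_simp
      _ ≤ _ := by gcongr
  have hcb : Metric.closedBall x₀ η ⊆ Ω := by
    refine Set.Subset.trans ?_ hδΩ'
    apply Metric.closedBall_subset_ball'
    rw [Metric.mem_ball] at hx₀b
    linarith
  have hub : ∀ x ∈ Ω, hyp κ x Yb (x₀, z₀) ≤ u x := fun x hx => by rw [hrb]; exact hYb.2 x hx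
  have huh : ∀ x ∈ Ω, hyp κ x Yh (x₀, z₀) ≤ u x := fun x hx => by rw [hrh]; exact hYh.2 x hx
  have hgood : ∀ Y ∈ Tgt, Good κ Δ T1 (x₀, z₀) Y := fun Y hY =>
    S.good _ hx₀Ω hz2 (hz1.trans (S.ur _ hx₀Ω).2) _ hY
  have hsub : {Y : E n × ℝ | ∃ lam ∈ Set.Icc (1/4 : ℝ) (3/4),
      YZlam κ sfun (x₀, z₀) Yb Yh lam ∈ Tgt ∧
      pnorm (Y - YZlam κ sfun (x₀, z₀) Yb Yh lam) < μ} ∩ Tgt ⊆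
      ⋃ x ∈ Metric.ball x₀ η, Fu κ Ω Tgt u x := by
    rintro Y ⟨⟨lam, hlam, hW, hYW⟩, hY⟩
    have hloc := hreg Yb hYb.1 Yh hYh.1 (x₀, z₀) hZ.1 lam hlam
    set W := YZlam κ sfun (x₀, z₀) Yb Yh lam with hWdef
    have hloc' : ∀ x, ‖x - x₀‖ ≤ η → x ∈ Ω ∧ hyp κ x W (x₀, z₀) ≤
        max (hyp κ x Yb (x₀, z₀)) (hyp κ x Yh (x₀, z₀)) - (c₁ * d ^ 2) * ‖x - x₀‖ ^ 2 := by
      intro x hx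
      have hxΩ : x ∈ Ω := hcb (by rwa [mem_closedBall_iff_norm])
      exact ⟨hxΩ, hloc x hxΩ (by simp only; linarith)⟩
    have hsph : ∀ x ∈ Ω, ‖x - x₀‖ = η → hyp κ x Y (x₀, u x₀) < u x := by
      intro x hx hxe
      refine S.far hY hW hx₀Ω hz1 hz2 hgap' hd hη hc hYW.le hμ' hM' hx hxe.ge (hub x hx) (huh x hx) ?_
      refine (hloc' x hxe.le).2.trans ?_
      gcongr
    obtain ⟨x', hx', hF⟩ := S.interior hY hη hcb hsph (by
      rcases hn.lt_or_eq with hn2 | hn1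
      · left
        have hg := glob_gap (Z := (x₀, z₀)) (W := W) (r := η) (A := c₁ * d ^ 2) hn2 hκ hΔ hT
          (hgood Yb hYb.1) (hgood Yh hYh.1) (hgood W hW) Ω
          (fun x hx => ⟨S.dT _ hYb.1 x hx, S.dT _ hYh.1 x hx, S.dT _ hW x hx, S.dO x hx x₀ hx₀Ω⟩)
          hη (by positivity) hloc'
        intro x hx hxe
        refine S.far hY hW hx₀Ω hz1 hz2 hgap' hd hη hc hYW.le hμ' hM' hx hxe (hub x hx) (huh x hx) ?_
        refine (hg x hx).trans ?_
        change _ - cG κ Δ T1 * (c₁ * d ^ 2) * ‖x - x₀‖ ^ 2 ≤ _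
        rw [← mul_assoc]
        gcongr
      · right
        subst hn1
        intro x y z hx hz hy h1 h2
        exact S.dim1 sfun hspos hparam hY hx hz hy h1 h2)
    simp only [Set.mem_iUnion]
    exact ⟨x', hx', hF⟩
  have hfin := (hgr Yb hYb.1 Yh hYh.1 (x₀, z₀) hZ.2 μ hμ0 hμlt).trans
    ((MeasureTheory.measure_mono hsub).trans (hgrowth2 x₀ η hη hcb))
  rwa [ENNReal.ofReal_le_ofReal_iff (by positivity)] at hfin

/-! ### Conclusion -/

lemma rp_conv {n : ℕ} (hn : 1 ≤ n) {Ctil C₀ cμ d η p : ℝ} (hCtil : 0 < Ctil) (hcμ : 0 < cμ)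
    (hd : 0 < d) (hη : 0 < η)
    (h : Ctil * (cμ * d ^ 2 * η) ^ (n - 1) * d ≤ C₀ * η ^ p) :
    d ^ (2 * ((n : ℝ) - 1) + 1) ≤ C₀ / (Ctil * cμ ^ (n - 1)) * η ^ (p - ((n : ℝ) - 1)) := by
  have hν : (n : ℝ) - 1 = ((n - 1 : ℕ) : ℝ) := by push_cast [hn]; ring
  rw [hν, Real.rpow_sub hη, Real.rpow_natCast, Real.rpow_add hd, Real.rpow_one,
    Real.rpow_mul hd.le, Real.rpow_natCast, Real.rpow_ofNat, div_mul_div_comm,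
    le_div_iff₀ (by positivity)]
  calc (d ^ 2) ^ (n - 1) * d * (Ctil * cμ ^ (n - 1) * η ^ (n - 1)) =
      Ctil * (cμ * d ^ 2 * η) ^ (n - 1) * d := by rw [mul_pow, mul_pow]; ring
    _ ≤ _ := h

lemma rp_fin {d e M C ν p : ℝ} (hd : 0 < d) (he : 0 < e) (hM : 0 < M) (hC : 0 < C) (hν : 0 ≤ ν)
    (hp : ν < p)
    (h : d ^ (2 * ν + 1) ≤ C * (M * Real.sqrt (e / d)) ^ (p - ν)) :
    d ≤ (C * M ^ (p - ν)) ^ (1 / (1 + 3 / 2 * ν + p / 2)) *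
      e ^ ((p / 2 - ν / 2) / (1 + 3 / 2 * ν + p / 2)) := by
  set B := 1 + 3 / 2 * ν + p / 2 with hB
  have hB0 : 0 < B := by rw [hB]; linarith
  have hs : Real.sqrt (e / d) ^ (p - ν) = e ^ (p / 2 - ν / 2) / d ^ (p / 2 - ν / 2) := by
    rw [Real.sqrt_eq_rpow, ← Real.rpow_mul (by positivity), ← Real.div_rpow he.le hd.le]
    congr 1
    ring
  rw [Real.mul_rpow hM.le (Real.sqrt_nonneg _), hs, ← mul_assoc, ← mul_div_assoc,
    le_div_iff₀ (by positivity), ← Real.rpow_add hd] at h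
  have hexp : 2 * ν + 1 + (p / 2 - ν / 2) = B := by rw [hB]; ring
  rw [hexp] at h
  have h2 := Real.rpow_le_rpow (by positivity) h (show 0 ≤ 1 / B by positivity)
  rw [← Real.rpow_mul hd.le, mul_one_div_cancel hB0.ne', Real.rpow_one,
    Real.mul_rpow (by positivity) (by positivity), ← Real.rpow_mul he.le] at h2
  rwa [mul_one_div] at h2

lemma rp_zero {d C a s η₀ : ℝ} (hd : 0 < d) (ha : 0 < a) (hη₀ : 0 < η₀)
    (h : ∀ η : ℝ, 0 < η → η ≤ η₀ → d ^ s ≤ C * η ^ a) : False := by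
  have hlim : Filter.Tendsto (fun η : ℝ => C * η ^ a) (nhdsWithin 0 (Set.Ioi 0)) (nhds 0) := by
    have : Filter.Tendsto (fun η : ℝ => C * η ^ a) (nhds 0) (nhds (C * (0:ℝ) ^ a)) :=
      ((Real.continuousAt_rpow_const 0 a (Or.inr ha.le)).tendsto).const_mul C
    rw [Real.zero_rpow ha.ne', mul_zero] at this
    exact this.mono_left nhdsWithin_le_nhds
  have h2 : ∀ᶠ η : ℝ in nhdsWithin 0 (Set.Ioi 0), d ^ s ≤ C * η ^ a := by
    have : ∀ᶠ η : ℝ in nhdsWithin 0 (Set.Ioi 0), η < η₀ :=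
      nhdsWithin_le_nhds (gt_mem_nhds hη₀)
    filter_upwards [this, self_mem_nhdsWithin] with η h1 h3
    exact h η h3 h1.le
  have := ge_of_tendsto hlim h2
  have : 0 < d ^ s := by positivity
  linarith

lemma alpha_pos {n : ℕ} (hn : 1 ≤ n) {q : ℝ} (hq1 : 1 ≤ q) (hq2 : q * ((n : ℝ) - 1) < (n : ℝ)) :
    0 ≤ (n : ℝ) - 1 ∧ (n : ℝ) - 1 < (n : ℝ) / q ∧ 0 < alphaExp n q ∧ alphaExp n q ≤ 1 ∧
    alphaExp n q = ((n : ℝ) / q / 2 - ((n : ℝ) - 1) / 2) /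
      (1 + 3 / 2 * ((n : ℝ) - 1) + (n : ℝ) / q / 2) := by
  have h1 : (1 : ℝ) ≤ n := by exact_mod_cast hn
  have hq0 : 0 < q := by linarith
  have h2 : (n : ℝ) - 1 < (n : ℝ) / q := by rw [lt_div_iff₀ hq0]; linarith
  have e : (n : ℝ) / (2 * q) = (n : ℝ) / q / 2 := by field_simp
  have hB : 0 < 1 + 3 / 2 * ((n : ℝ) - 1) + (n : ℝ) / q / 2 := by linarith
  refine ⟨by linarith, h2, ?_, ?_, ?_⟩
  · unfold alphaExp
    rw [e]
    apply div_pos <;> linarith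
  · unfold alphaExp
    rw [e, div_le_one hB]
    linarith
  · unfold alphaExp
    rw [e]

lemma le_rpow_of_le {e D a : ℝ} (he : 0 ≤ e) (heD : e ≤ D) (ha : 0 < a) (ha1 : a ≤ 1) :
    e ≤ D ^ (1 - a) * e ^ a := by
  have h1 : e = e ^ (1 - a) * e ^ a := by
    rw [← Real.rpow_add_of_nonneg he (by linarith) ha.le]
    simp
  calc e = e ^ (1 - a) * e ^ a := h1
    _ ≤ _ := by
      gcongr

/-- Differentiability at a point from Hölder continuity of the refractor map. -/
lemma Stp.diff {n : ℕ} {κ τ₀ Δ T1 : ℝ} {Ω : Set (E n)} {Tgt : Set (E n × ℝ)} {u : E n → ℝ}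
    (S : Stp κ τ₀ Δ T1 Ω Tgt u) {D : Set (E n)} (hDo : IsOpen D) (hDΩ : D ⊆ Ω) {CH a : ℝ}
    (hCH : 0 < CH) (ha : 0 < a) (ha1 : a ≤ 1)
    (hH : ∀ xb ∈ D, ∀ xh ∈ D, ∀ Yb ∈ Fu κ Ω Tgt u xb, ∀ Yh ∈ Fu κ Ω Tgt u xh,
      pnorm (Yb - Yh) ≤ CH * ‖xb - xh‖ ^ a) :
    ∃ C : ℝ, 0 < C ∧
    (∀ xb ∈ D, ∀ xh ∈ D, ∀ Yb ∈ Fu κ Ω Tgt u xb, ∀ Yh ∈ Fu κ Ω Tgt u xh,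
      ‖gv κ (xb, u xb) Yb - gv κ (xh, u xh) Yh‖ ≤ C * ‖xb - xh‖ ^ a) ∧
    (∀ xb ∈ D, ∀ Yb ∈ Fu κ Ω Tgt u xb, HasGradientAt u (gv κ (xb, u xb) Yb) xb) ∧
    (∀ xb ∈ D, ∀ Yb ∈ Fu κ Ω Tgt u xb,
      gradient (fun z => hyp κ z Yb (xb, u xb)) xb = gv κ (xb, u xb) Yb) := by
  have hκ := S.hκ
  have hΔ := S.hΔ
  have hκ0 : 0 < κ := by linarith
  have hK : 0 < κ ^ 2 - 1 := by nlinarith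
  have hs : 0 < Real.sqrt (κ ^ 2 - 1) := Real.sqrt_pos.2 hK
  have hLg := S.gv_lip0
  set C := Lg κ Δ * (CH + (1 + 1 / Real.sqrt (κ ^ 2 - 1)) * Δ ^ (1 - a)) with hC
  have hC0 : 0 < C := by positivity
  have hgl : ∀ xb ∈ D, ∀ xh ∈ D, ∀ Yb ∈ Fu κ Ω Tgt u xb, ∀ Yh ∈ Fu κ Ω Tgt u xh,
      ‖gv κ (xb, u xb) Yb - gv κ (xh, u xh) Yh‖ ≤ C * ‖xb - xh‖ ^ a := by
    intro xb hxb xh hxh Yb hYb Yh hYh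
    have h1 := gv_lip hκ hΔ (S.goodu (hDΩ hxb) hYb.1) (S.goodu (hDΩ hxh) hYh.1)
    have h2 := hH xb hxb xh hxh Yb hYb Yh hYh
    have h3 : pnorm ((xb, u xb) - (xh, u xh) : E n × ℝ) ≤
        (1 + 1 / Real.sqrt (κ ^ 2 - 1)) * ‖xb - xh‖ := by
      refine (pnorm_le _).trans ?_
      have := S.lip (hDΩ hxb) (hDΩ hxh)
      simp only [Prod.mk_sub_mk]
      calc _ ≤ ‖xb - xh‖ + ‖xb - xh‖ / Real.sqrt (κ ^ 2 - 1) := by gcongr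
        _ = _ := by ring
    have h4 := le_rpow_of_le (norm_nonneg (xb - xh)) (S.dO xb (hDΩ hxb) xh (hDΩ hxh)) ha ha1
    refine h1.trans ?_
    change Lg κ Δ * _ ≤ _
    calc Lg κ Δ * (pnorm (Yb - Yh) + pnorm ((xb, u xb) - (xh, u xh) : E n × ℝ))
        ≤ Lg κ Δ * (CH * ‖xb - xh‖ ^ a + (1 + 1 / Real.sqrt (κ ^ 2 - 1)) *
          (Δ ^ (1 - a) * ‖xb - xh‖ ^ a)) := by
          gcongr
          exact h3.trans (by gcongr)
      _ = _ := by rw [hC]; ring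
  refine ⟨C, hC0, hgl, ?_, ?_⟩
  · intro xb hxb Yb hYb
    apply hasGradientAt_of_bound (C := C + Δ ^ (1 - a) / (2 * κ * Δ)) ha
    filter_upwards [hDo.mem_nhds hxb] with x hx
    obtain ⟨Y, hY⟩ := S.ne x (hDΩ hx)
    have t1 := tangent_lower hκ hΔ (S.goodu (hDΩ hxb) hYb.1) x
    have t2 := tangent_lower hκ hΔ (S.goodu (hDΩ hx) hY.1) xb
    have l1 := hYb.2 x (hDΩ hx)
    have l2 := hY.2 xb (hDΩ hxb)
    simp only at t1 t2
    have hg := hgl x hx xb hxb Y hY Yb hYb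
    have h4 := le_rpow_of_le (norm_nonneg (x - xb)) (S.dO x (hDΩ hx) xb (hDΩ hxb)) ha ha1
    rw [norm_sub_rev, ← neg_sub x xb, inner_neg_left] at t2
    have hin : ⟪x - xb, gv κ (x, u x) Y⟫ - ⟪x - xb, gv κ (xb, u xb) Yb⟫ ≤
        C * ‖x - xb‖ ^ a * ‖x - xb‖ := by
      rw [← inner_sub_right]
      refine (real_inner_le_norm _ _).trans ?_
      rw [mul_comm]
      gcongr
    have hsq : ‖x - xb‖ ^ 2 / (2 * κ * Δ) ≤ Δ ^ (1 - a) / (2 * κ * Δ) * ‖x - xb‖ ^ a * ‖x - xb‖ := by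
      calc ‖x - xb‖ ^ 2 / (2 * κ * Δ) = ‖x - xb‖ * ‖x - xb‖ / (2 * κ * Δ) := by ring
        _ ≤ (Δ ^ (1 - a) * ‖x - xb‖ ^ a) * ‖x - xb‖ / (2 * κ * Δ) := by gcongr
        _ = _ := by ring
    have hp : 0 ≤ C * ‖x - xb‖ ^ a * ‖x - xb‖ := by positivity
    have hex : (C + Δ ^ (1 - a) / (2 * κ * Δ)) * ‖x - xb‖ ^ a * ‖x - xb‖ =
      C * ‖x - xb‖ ^ a * ‖x - xb‖ + Δ ^ (1 - a) / (2 * κ * Δ) * ‖x - xb‖ ^ a * ‖x - xb‖ := by ring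
    rw [hex, abs_le]
    constructor <;> linarith
  · intro xb hxb Yb hYb
    have := hyp_grad hκ hΔ (S.goodu (hDΩ hxb) hYb.1) (by
      filter_upwards [S.op.mem_nhds (hDΩ hxb)] with x hx
      exact S.dT Yb hYb.1 x hx)
    exact this.gradient

lemma mkStp {n : ℕ} (κ : ℝ) (hκ : 1 < κ)
    (Ω : Set (E n)) (hΩo : IsOpen Ω) (hΩconv : Convex ℝ Ω)
    (hΩb : Bornology.IsBounded Ω)
    (Tgt : Set (E n × ℝ)) (hTne : Tgt.Nonempty)
    (τ₀ τ₁ ω Δ : ℝ) (hτ₀ : 0 < τ₀) (hτ : τ₀ < τ₁) (hω : 0 < ω) (hΔpos : 0 < Δ)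
    (hslab : ∀ Y ∈ Tgt, Y.2 ∈ Set.Icc τ₁ (τ₁ + ω))
    (hΔ : ∀ Y ∈ Tgt, Metric.diam (Ω ∪ {Y.1}) ≤ Δ)
    (hcompat : max (κ * τ₀) (τ₀ + κ * Δ / (κ - 1)) ≤ τ₁)
    (u : E n → ℝ) (hurange : ∀ x ∈ Ω, u x ∈ Set.Icc 0 τ₀)
    (hu : ∀ x₀ ∈ Ω, ∃ Y ∈ Tgt, ∃ b : ℝ, 0 < b ∧
      b < κ * Y.2 - Real.sqrt (Y.2 ^ 2 + Δ ^ 2) ∧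
      (∀ x ∈ Ω, hypb κ Y b x ≤ u x) ∧ u x₀ = hypb κ Y b x₀) :
    Stp κ τ₀ Δ (τ₁ + ω + Δ / Real.sqrt (κ ^ 2 - 1)) Ω Tgt u := by
  have hK : 0 < κ ^ 2 - 1 := by nlinarith
  have hs : 0 < Real.sqrt (κ ^ 2 - 1) := Real.sqrt_pos.2 hK
  have hbd : ∀ Y : E n × ℝ, Bornology.IsBounded (Ω ∪ {Y.1}) := fun Y =>
    hΩb.union Bornology.isBounded_singleton
  have hdT : ∀ Y ∈ Tgt, ∀ x ∈ Ω, ‖x - Y.1‖ ≤ Δ := by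
    intro Y hY x hx
    rw [← dist_eq_norm]
    exact (Metric.dist_le_diam_of_mem (hbd Y) (Or.inl hx) (Or.inr rfl)).trans (hΔ Y hY)
  have hτ₁ : 0 < τ₁ := by linarith
  refine ⟨hκ, hΔpos, by positivity, hΩo, hΩconv, hdT, ?_, ?_, hurange, ?_⟩
  · intro x hx y hy
    obtain ⟨Y, hY⟩ := hTne
    rw [← dist_eq_norm]
    exact (Metric.dist_le_diam_of_mem (hbd Y) (Or.inl hx) (Or.inl hy)).trans (hΔ Y hY)
  · intro Z hZ1 hZ2 hZ3 Y hY
    have hsl := hslab Y hY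
    have h2 := (le_max_right _ _).trans hcompat
    refine ⟨?_, ?_, ?_⟩
    · rw [norm_sub_rev]; exact hdT Y hY _ hZ1
    · linarith [hsl.1]
    · linarith [hsl.2]
  · intro x hx
    obtain ⟨Y, hY, b, hb, _, hle, heq⟩ := hu x hx
    refine ⟨Y, hY, ?_⟩
    have := (hypb_eq_iff hκ Y x (u x) hb).1 heq.symm
    intro y hy
    unfold hyp
    rw [this]
    exact hle y hy

/-- C^{1,α} estimates for parallel refractors. -/
theorem stmt_17 {n : ℕ} (hn : 1 ≤ n) (κ : ℝ) (hκ : 1 < κ)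
    (Ω : Set (E n)) (hΩo : IsOpen Ω) (hΩconv : Convex ℝ Ω)
    (hΩb : Bornology.IsBounded Ω) (hΩne : Ω.Nonempty)
    (Tgt : Set (E n × ℝ)) (hTc : IsCompact Tgt) (hTne : Tgt.Nonempty)
    (τ₀ τ₁ ω Δ : ℝ) (hτ₀ : 0 < τ₀) (hτ : τ₀ < τ₁) (hω : 0 < ω) (hΔpos : 0 < Δ)
    (hslab : ∀ Y ∈ Tgt, Y.2 ∈ Set.Icc τ₁ (τ₁ + ω))
    (hΔ : ∀ Y ∈ Tgt, Metric.diam (Ω ∪ {Y.1}) ≤ Δ)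
    (hcompat : max (κ * τ₀) (τ₀ + κ * Δ / (κ - 1)) ≤ τ₁)
    (u : E n → ℝ) (hurange : ∀ x ∈ Ω, u x ∈ Set.Icc 0 τ₀)
    (hu : ∀ x₀ ∈ Ω, ∃ Y ∈ Tgt, ∃ b : ℝ, 0 < b ∧
      b < κ * Y.2 - Real.sqrt (Y.2 ^ 2 + Δ ^ 2) ∧
      (∀ x ∈ Ω, hypb κ Y b x ≤ u x) ∧ u x₀ = hypb κ Y b x₀)
    (sfun : (E n × ℝ) → (E n × ℝ) → ℝ)
    (hspos : ∀ X d, 0 < sfun X d)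
    (hslip : ∀ X : E n × ℝ, ∃ K : NNReal, LipschitzWith K (sfun X))
    (hparam : ∀ X : E n × ℝ, X.1 ∈ Ω → X.2 ∈ Set.Icc 0 τ₀ → ∀ Y ∈ Tgt,
      ∃ d : E n × ℝ, pnorm d = 1 ∧ Y = X + sfun X d • d)
    (xstar : E n) (hxstar : xstar ∈ Ω)
    (hreg : ∃ U ∈ nhds ((xstar, u xstar) : E n × ℝ), ∃ c₁ : ℝ, 0 < c₁ ∧ ∃ c₂ : ℝ, 0 < c₂ ∧
      ∀ Yb ∈ Tgt, ∀ Yh ∈ Tgt, ∀ Z ∈ U, ∀ lam ∈ Set.Icc (1/4 : ℝ) (3/4),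
        ∀ x ∈ Ω, ‖x - Z.1‖ ≤ c₂ →
          hyp κ x (YZlam κ sfun Z Yb Yh lam) Z
            ≤ max (hyp κ x Yb Z) (hyp κ x Yh Z)
              - c₁ * (pnorm (Yb - Yh)) ^ 2 * ‖x - Z.1‖ ^ 2)
    (σ : MeasureTheory.Measure (E n × ℝ))
    (q : ℝ) (hq1 : 1 ≤ q) (hq2 : q * ((n : ℝ) - 1) < (n : ℝ))
    (Ctil C₀ : ℝ) (hCtil : 0 < Ctil) (hC₀ : 0 < C₀)
    (hgrowth1 : ∃ U ∈ nhds ((xstar, u xstar) : E n × ℝ), ∃ μ₀ : ℝ, 0 < μ₀ ∧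
      ∀ Yb ∈ Tgt, ∀ Yh ∈ Tgt, ∀ Z ∈ U, ∀ μ : ℝ, 0 < μ → μ < μ₀ →
        ENNReal.ofReal (Ctil * μ ^ (n - 1) * pnorm (Yb - Yh))
          ≤ σ ({Y : E n × ℝ | ∃ lam ∈ Set.Icc (1/4 : ℝ) (3/4),
                YZlam κ sfun Z Yb Yh lam ∈ Tgt ∧
                pnorm (Y - YZlam κ sfun Z Yb Yh lam) < μ} ∩ Tgt))
    (hgrowth2 : ∀ (z : E n) (r : ℝ), 0 < r → Metric.closedBall z r ⊆ Ω →
      σ (⋃ x ∈ Metric.ball z r, Fu κ Ω Tgt u x) ≤ ENNReal.ofReal (C₀ * r ^ ((n : ℝ) / q))) :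
    ∃ δ : ℝ, 0 < δ ∧ ∃ M : ℝ, 0 < M ∧ ∃ C₂ : ℝ, 0 < C₂ ∧
      ∃ C₁ : ℝ, 0 < C₁ ∧ ∃ C : ℝ, 0 < C ∧
      Metric.ball xstar δ ⊆ Ω ∧
      (∀ xb ∈ Metric.ball xstar (δ / 2), ∀ xh ∈ Metric.ball xstar (δ / 2),
        ∀ Yb ∈ Fu κ Ω Tgt u xb, ∀ Yh ∈ Fu κ Ω Tgt u xh,
          max 1 (max ((2 * M / δ) ^ 2) ((2 * M / C₂) ^ 2)) * ‖xb - xh‖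
            ≤ pnorm (Yb - Yh) →
          pnorm (Yb - Yh) ≤ C₁ * ‖xb - xh‖ ^ alphaExp n q) ∧
      (∀ x ∈ Metric.ball xstar (δ / 2), ∃! Y : E n × ℝ, Y ∈ Fu κ Ω Tgt u x) ∧
      (∀ xb ∈ Metric.ball xstar (δ / 2), ∀ Yb ∈ Fu κ Ω Tgt u xb,
        HasGradientAt u (gradient (fun z => hyp κ z Yb (xb, u xb)) xb) xb) ∧
      (∀ xb ∈ Metric.ball xstar (δ / 2), ∀ xh ∈ Metric.ball xstar (δ / 2),
        ‖gradient u xb - gradient u xh‖ ≤ C * ‖xb - xh‖ ^ alphaExp n q) := by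
  have S := mkStp κ hκ Ω hΩo hΩconv hΩb Tgt hTne τ₀ τ₁ ω Δ hτ₀ hτ hω hΔpos hslab hΔ hcompat u
    hurange hu
  obtain ⟨δ, hδ, M, hM, C₂, hC₂, cμ, hcμ, hball, hkey⟩ := S.key hn sfun hspos hparam xstar hxstar
    hreg σ q Ctil C₀ hC₀ hgrowth1 hgrowth2
  obtain ⟨hν, hp, hα0, hα1, hαe⟩ := alpha_pos hn hq1 hq2
  set ν := (n : ℝ) - 1 with hνdef
  set p := (n : ℝ) / q with hpdef
  set α := alphaExp n q with hα
  set C := C₀ / (Ctil * cμ ^ (n - 1)) with hCdef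
  have hC : 0 < C := by positivity
  set C₁ := (C * M ^ (p - ν)) ^ (1 / (1 + 3 / 2 * ν + p / 2)) with hC₁def
  have hC₁ : 0 < C₁ := by positivity
  set Kc := max 1 (max ((2 * M / δ) ^ 2) ((2 * M / C₂) ^ 2)) with hKc
  have hK1 : 1 ≤ Kc := le_max_left _ _
  have hK2 : (2 * M / δ) ^ 2 ≤ Kc := (le_max_left _ _).trans (le_max_right _ _)
  have hK3 : (2 * M / C₂) ^ 2 ≤ Kc := (le_max_right _ _).trans (le_max_right _ _)
  have hmain : ∀ xb ∈ Metric.ball xstar (δ / 2), ∀ xh ∈ Metric.ball xstar (δ / 2),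
        ∀ Yb ∈ Fu κ Ω Tgt u xb, ∀ Yh ∈ Fu κ Ω Tgt u xh,
          Kc * ‖xb - xh‖ ≤ pnorm (Yb - Yh) →
          pnorm (Yb - Yh) ≤ C₁ * ‖xb - xh‖ ^ α := by
    intro xb hxb xh hxh Yb hYb Yh hYh hle
    have hk := hkey xb hxb xh hxh Yb hYb Yh hYh
    set d := pnorm (Yb - Yh) with hd
    set e := ‖xb - xh‖ with he
    have he0 : 0 ≤ e := norm_nonneg _
    have hd0 : 0 ≤ d := pnorm_nonneg _
    have hed : e ≤ d := by
      calc e = 1 * e := (one_mul _).symm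
        _ ≤ Kc * e := by gcongr
        _ ≤ d := hle
    rcases hd0.eq_or_lt with hdz | hdpos
    · rw [← hdz]; positivity
    have hk2 := hk hed hdpos
    rcases he0.eq_or_lt with hez | hepos
    · exfalso
      refine rp_zero (d := d) (C := C) (a := p - ν) (s := 2 * ν + 1) (η₀ := min (δ / 2) (C₂ / 2))
        hdpos (by linarith) (lt_min (by positivity) (by positivity)) ?_
      intro η hη hηle
      refine rp_conv hn hCtil hcμ hdpos hη (hk2 η hη (hηle.trans (min_le_left _ _))
        (hηle.trans (min_le_right _ _)) ?_)
      rw [← hez, mul_zero]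
      positivity
    · have hq0 : 0 < e / d := by positivity
      have hsm : ∀ t : ℝ, 0 < t → (2 * M / t) ^ 2 ≤ Kc → M * Real.sqrt (e / d) ≤ t / 2 := by
        intro t ht hKt
        have h1 : (2 * M / t) ^ 2 * (e / d) ≤ 1 := by
          rw [← mul_div_assoc, div_le_one hdpos]
          refine le_trans ?_ hle
          gcongr
        have h2 : (2 * M / t) * Real.sqrt (e / d) ≤ 1 := by
          have h3 : ((2 * M / t) * Real.sqrt (e / d)) ^ 2 ≤ 1 := by
            rw [mul_pow, Real.sq_sqrt hq0.le]; exact h1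
          exact (sq_le_one_iff₀ (by positivity)).1 h3
        calc M * Real.sqrt (e / d) = (t / 2) * ((2 * M / t) * Real.sqrt (e / d)) := by field_simp
          _ ≤ (t / 2) * 1 := by gcongr
          _ = t / 2 := mul_one _
      have hη : 0 < M * Real.sqrt (e / d) := mul_pos hM (Real.sqrt_pos.2 hq0)
      have h5 := rp_conv hn hCtil hcμ hdpos hη (hk2 _ hη (hsm δ hδ hK2) (hsm C₂ hC₂ hK3) (by
        rw [mul_pow, Real.sq_sqrt hq0.le]
        apply le_of_eq
        field_simp))
      have h6 := rp_fin hdpos hepos hM hC hν hp h5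
      rw [hαe]
      exact h6
  have hD : Metric.ball xstar (δ / 2) ⊆ Ω := (Metric.ball_subset_ball (by linarith)).trans hball
  have hH : ∀ xb ∈ Metric.ball xstar (δ / 2), ∀ xh ∈ Metric.ball xstar (δ / 2),
        ∀ Yb ∈ Fu κ Ω Tgt u xb, ∀ Yh ∈ Fu κ Ω Tgt u xh,
          pnorm (Yb - Yh) ≤ (C₁ + Kc * Δ ^ (1 - α)) * ‖xb - xh‖ ^ α := by
    intro xb hxb xh hxh Yb hYb Yh hYh
    have hpow : 0 ≤ ‖xb - xh‖ ^ α := by positivity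
    rcases le_total (Kc * ‖xb - xh‖) (pnorm (Yb - Yh)) with h | h
    · refine (hmain xb hxb xh hxh Yb hYb Yh hYh h).trans ?_
      gcongr
      have : 0 ≤ Kc * Δ ^ (1 - α) := by positivity
      linarith
    · have h4 := le_rpow_of_le (norm_nonneg (xb - xh)) (S.dO xb (hD hxb) xh (hD hxh)) hα0 hα1
      calc pnorm (Yb - Yh) ≤ Kc * ‖xb - xh‖ := h
        _ ≤ Kc * (Δ ^ (1 - α) * ‖xb - xh‖ ^ α) := by gcongr
        _ = 0 + Kc * Δ ^ (1 - α) * ‖xb - xh‖ ^ α := by ring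
        _ ≤ C₁ * ‖xb - xh‖ ^ α + Kc * Δ ^ (1 - α) * ‖xb - xh‖ ^ α := by gcongr; positivity
        _ = _ := by ring
  obtain ⟨Cf, hCf, hgl, hgrad, hhyp⟩ := S.diff Metric.isOpen_ball hD
    (show 0 < C₁ + Kc * Δ ^ (1 - α) by positivity) hα0 hα1 hH
  refine ⟨δ, hδ, M, hM, C₂, hC₂, C₁, hC₁, Cf, hCf, hball, hmain, ?_, ?_, ?_⟩
  · intro x hx
    obtain ⟨Y, hY⟩ := S.ne x (hD hx)
    refine ⟨Y, hY, ?_⟩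
    intro Y' hY'
    have h := hH x hx x hx Y' hY' Y hY
    rw [sub_self, norm_zero, Real.zero_rpow hα0.ne', mul_zero] at h
    exact sub_eq_zero.1 (pnorm_eq_zero (le_antisymm h (pnorm_nonneg _)))
  · intro xb hxb Yb hYb
    rw [hhyp xb hxb Yb hYb]
    exact hgrad xb hxb Yb hYb
  · intro xb hxb xh hxh
    obtain ⟨Yb, hYb⟩ := S.ne xb (hD hxb)
    obtain ⟨Yh, hYh⟩ := S.ne xh (hD hxh)
    rw [(hgrad xb hxb Yb hYb).gradient, (hgrad xh hxh Yh hYh).gradient]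
    exact hgl xb hxb xh hxh Yb hYb Yh hYh
end
end
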